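/- Let (R,m,k) be a regular local ring of dimension n and assume that the order ideal conjecture holds for every regular local ring of dimension n−1. Let I be an ideal of height d with minimal set of generators x_1,…,x_s. If I contains an element of m ∖ m², or if depth R/I > 0, then for every i ≥ 1 the natural map K_{d+i}(x;R) ⊗_R k → Tor_{d+i}^R(R/I, k) is the zero map. -/

import Mathlib

open IsLocalRing

universe u

variable (R : Type u) [CommRing R]

/-- Index type for the degree-`n` part of the Koszul complex on `s` generators:
`n`-element subsets of `Fin s` (i.e. strictly increasing `n`-tuples). -/
abbrev KIdx (s n : ℕ) : Type := {T : Finset (Fin s) // T.card = n}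

/-- The degree-`n` part of the Koszul complex `K_•(x₁,…,x_s; R)`:
the free `R`-module on `KIdx s n`. -/
abbrev KMod (s n : ℕ) : Type u := KIdx s n →₀ R

/-- The Koszul differential `K_{n+1}(x;R) → K_n(x;R)`,
`e_T ↦ ∑_{j ∈ T} (-1)^{#{i ∈ T : i < j}} x_j e_{T∖{j}}`. -/
noncomputable def koszulD {s : ℕ} (x : Fin s → R) (n : ℕ) :
    KMod R s (n + 1) →ₗ[R] KMod R s n :=
  Finsupp.lsum R fun T => LinearMap.toSpanSingleton R (KMod R s n)
    (∑ j ∈ T.1.attach,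
      ((-1 : R) ^ (T.1.filter (fun i => i < j.1)).card * x j.1) •
        Finsupp.single ⟨T.1.erase j.1, by
          simp [Finset.card_erase_of_mem j.2, T.2]⟩ (1 : R))

/-- A projective resolution `⋯ → F 1 → F 0 → M → 0` of an `R`-module `M`. -/
structure ProjRes (M : Type u) [AddCommGroup M] [Module R M] where
  F : ℕ → ModuleCat.{u} R
  d : ∀ n, F (n + 1) →ₗ[R] F n
  ε : F 0 →ₗ[R] M
  projective : ∀ n, Module.Projective R (F n)
  surj : Function.Surjective ε
  exact0 : LinearMap.ker ε = LinearMap.range (d 0)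
  exact : ∀ n, LinearMap.ker (d n) = LinearMap.range (d (n + 1))

/-- A chain map `ψ : K_•(x;R) → F_•` lifting the natural surjection
`R/(x₁,…,x_s) → R/I` (for `(x) ⊆ I`), where `F_•` is a projective resolution of
`R/I`.  The condition `aug` says that on `K_0 = R·e_∅` the augmentations are
compatible: `ε(ψ₀(r·e_∅)) = r mod I`. -/
structure KoszulLift {s : ℕ} (x : Fin s → R) (I : Ideal R)
    (P : ProjRes R (R ⧸ I)) where
  ψ : ∀ n, KMod R s n →ₗ[R] P.F n
  comm : ∀ n, (ψ n).comp (koszulD R x n) = (P.d n).comp (ψ (n + 1))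
  aug : ∀ v : KMod R s 0, P.ε (ψ 0 v) = Ideal.Quotient.mk I (v ⟨∅, rfl⟩)

/-- The natural map `K_i(x;R) ⊗ k → Tor_i^R(R/I, k)` is the zero map: for every
projective resolution `F_•` of `R/I` and every chain map `ψ : K_•(x;R) → F_•`
lifting the natural surjection `R/(x) → R/I`, every element of `ψ_i(K_i)` lies in
`im(d_{i+1}) + m·F_i`.  (As every element of `K_i ⊗ k` is a cycle, the induced
map on `i`-th homology `K_i ⊗ k → H_i(F_• ⊗ k) = Tor_i^R(R/I,k)` is zero exactly
when `ψ_i(K_i) ⊆ im(d_{i+1}) + m·F_i`.) -/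
def KoszulTorMapZero [IsLocalRing R] {s : ℕ} (x : Fin s → R) (I : Ideal R)
    (i : ℕ) : Prop :=
  ∀ (P : ProjRes R (R ⧸ I)) (L : KoszulLift R x I P) (v : KMod R s i),
    L.ψ i v ∈ LinearMap.range (P.d i) ⊔ (maximalIdeal R) • (⊤ : Submodule R (P.F i))

/-- The grade of the ideal `J` is at least `k`: either `J = R` (grade `+∞` by
convention), or `J` contains a weakly `R`-regular sequence of length `k`. -/
def GradeGE (J : Ideal R) (k : ℕ) : Prop :=
  J = ⊤ ∨ ∃ rs : List R, rs.length = k ∧ (∀ r ∈ rs, r ∈ J) ∧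
    RingTheory.Sequence.IsWeaklyRegular R rs

/-- The order ideal `O_M(y) = {f(y) : f ∈ Hom_R(M, R)}` of `y : M`. -/
def orderIdeal {M : Type u} [AddCommGroup M] [Module R M] (y : M) : Ideal R :=
  LinearMap.range (LinearMap.applyₗ (R := R) (M := M) (M₂ := R) y)

/-- `M` has a finite resolution by finitely generated free modules; for a
finitely generated module over a Noetherian local ring this says exactly that
`M` has finite projective dimension. -/
def HasFiniteFreeResolution (M : Type u) [AddCommGroup M] [Module R M] : Prop :=
  ∃ (P : ProjRes R M) (n : ℕ),
    (∀ j, Module.Free R (P.F j) ∧ Module.Finite R (P.F j)) ∧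
    ∀ j, n ≤ j → Subsingleton (P.F j)

/-- `M` is a `k`-th syzygy: there is an exact sequence
`0 → M → F_{k-1} → ⋯ → F_0 → N → 0` with the `F_j` finitely generated free;
equivalently (continuing the resolution), `M` is isomorphic to the `k`-th syzygy
module `im(d_{k-1})` of some resolution of `N` by finitely generated free
modules. -/
def IsSyzygy (k : ℕ) (M : Type u) [AddCommGroup M] [Module R M] : Prop :=
  match k with
  | 0 => True
  | (j + 1) => ∃ (N : Type u) (_ : AddCommGroup N) (_ : Module R N)
      (P : ProjRes R N),
        (∀ n, Module.Free R (P.F n) ∧ Module.Finite R (P.F n)) ∧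
        Nonempty (M ≃ₗ[R] ↥(LinearMap.range (P.d j)))

/-- The order ideal conjecture holds for the local ring `R`: for every finitely
generated `R`-module `M` of finite projective dimension which is a `k`-th syzygy
and every minimal generator `y` of `M` (i.e. `y ∉ mM`), the order ideal `O_M(y)`
has grade at least `k`. -/
def OrderIdealConjecture [IsLocalRing R] : Prop :=
  ∀ (M : Type u) (_ : AddCommGroup M) (_ : Module R M),
    Module.Finite R M → HasFiniteFreeResolution R M →
      ∀ k : ℕ, IsSyzygy R k M →
        ∀ y : M, y ∉ (maximalIdeal R) • (⊤ : Submodule R M) →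
          GradeGE R (orderIdeal R y) k

/-- `R` is a regular local ring: a Noetherian local ring whose maximal ideal is
generated by `dim R` elements. -/
def IsRegularLocal [IsLocalRing R] : Prop :=
  IsNoetherianRing R ∧ ∃ (n : ℕ) (x : Fin n → R),
    Ideal.span (Set.range x) = maximalIdeal R ∧ ringKrullDim R = n

/-- The ideal `I` has height `d`: `d` is the minimum of the heights of the primes
containing `I`, the height of a prime `P` being `dim R_P`. -/
def HeightEq (I : Ideal R) (d : ℕ) : Prop :=
  (∃ (P : Ideal R) (h : P.IsPrime), I ≤ P ∧
      ringKrullDim (@Localization.AtPrime R _ P h) = d) ∧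
    ∀ (P : Ideal R) (h : P.IsPrime), I ≤ P →
      (d : WithBot ℕ∞) ≤ ringKrullDim (@Localization.AtPrime R _ P h)

/-- `x₁, …, x_s` is a minimal set of generators of `I`: the `x_j` generate `I`
and no `x_j` is redundant (over a local ring this says exactly that
`s = dim_k I/mI`). -/
def MinimalGenerators {s : ℕ} (x : Fin s → R) (I : Ideal R) : Prop :=
  Ideal.span (Set.range x) = I ∧
    ∀ j, x j ∉ Ideal.span (x '' ({j}ᶜ : Set (Fin s)))

/-- `R` is a regular local ring of dimension `n`. -/
structure IsRegularLocalOfDim (R : Type u) [CommRing R] [IsLocalRing R] (n : ℕ) : Prop where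
  noetherian : IsNoetherianRing R
  exists_span : ∃ x : Fin n → R, Ideal.span (Set.range x) = maximalIdeal R
  dim : ringKrullDim R = n

namespace IsRegularLocalOfDim

variable {R : Type u} [CommRing R] [IsLocalRing R] {n : ℕ}

lemma of_isRegularLocal (h : IsRegularLocal R) (hn : ringKrullDim R = n) :
    IsRegularLocalOfDim R n := by
  obtain ⟨h1, k, x, hx, hk⟩ := h
  obtain rfl : k = n := by
    rw [hk] at hn; exact_mod_cast hn
  exact ⟨h1, ⟨x, hx⟩, hk⟩

lemma isRegularLocal (h : IsRegularLocalOfDim R n) : IsRegularLocal R :=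
  ⟨h.noetherian, n, h.exists_span.choose, h.exists_span.choose_spec, h.dim⟩

lemma maximalIdeal_eq_bot (h : IsRegularLocalOfDim R 0) : maximalIdeal R = ⊥ := by
  obtain ⟨x, hx⟩ := h.exists_span
  rw [← hx]; simp

end IsRegularLocalOfDim

lemma isLocalRing_quotient {R : Type u} [CommRing R] [IsLocalRing R] {J : Ideal R}
    (hJ : J ≤ maximalIdeal R) : IsLocalRing (R ⧸ J) := by
  have : Nontrivial (R ⧸ J) := Ideal.Quotient.nontrivial_iff.mpr
    (fun h => (maximalIdeal.isMaximal R).ne_top (top_le_iff.mp (h ▸ hJ)))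
  exact IsLocalRing.of_surjective' (Ideal.Quotient.mk J) Ideal.Quotient.mk_surjective

lemma span_singleton_le_maximalIdeal {R : Type u} [CommRing R] [IsLocalRing R] {w : R}
    (hw : w ∈ maximalIdeal R) : Ideal.span {w} ≤ maximalIdeal R :=
  (Ideal.span_singleton_le_iff_mem _).mpr hw

lemma ringKrullDim_le_ringKrullDim_quotient_span_singleton_add_one {R : Type u} [CommRing R]
    [IsNoetherianRing R] [IsLocalRing R] {w : R} (hw : w ∈ maximalIdeal R) :
    ringKrullDim R ≤ ringKrullDim (R ⧸ Ideal.span {w}) + 1 := by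
  have h1 := ringKrullDim_le_ringKrullDim_quotient_add_encard ({w} : Set R) (by
    simpa [IsLocalRing.ringJacobson_eq_maximalIdeal] using hw)
  simpa using h1

lemma IsRegularLocalOfDim.quotient {R : Type u} [CommRing R] [IsLocalRing R] {n : ℕ}
    (h : IsRegularLocalOfDim R (n + 1)) {w : R} (hw : w ∈ maximalIdeal R)
    (hw2 : w ∉ maximalIdeal R ^ 2) [IsLocalRing (R ⧸ Ideal.span {w})] :
    IsRegularLocalOfDim (R ⧸ Ideal.span {w}) n := by
  have := h.noetherian
  obtain ⟨x, hx⟩ := h.exists_span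
  have hw' := hw
  rw [← hx, Ideal.mem_span_range_iff_exists_fun] at hw'
  obtain ⟨a, ha⟩ := hw'
  have hxm : ∀ i, x i ∈ maximalIdeal R := fun i => hx ▸ Ideal.subset_span ⟨i, rfl⟩
  obtain ⟨j, hj⟩ : ∃ j, IsUnit (a j) := by
    by_contra! hcon
    apply hw2
    rw [← ha, pow_two]
    exact Ideal.sum_mem _ fun i _ => Ideal.mul_mem_mul ((mem_maximalIdeal _).mpr (hcon i)) (hxm i)
  have hspan : Ideal.span
      (Set.range fun i => Ideal.Quotient.mk (Ideal.span {w}) (x (j.succAbove i)))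
      = maximalIdeal (R ⧸ Ideal.span {w}) := by
    rw [← map_maximalIdeal_of_surjective (Ideal.Quotient.mk (Ideal.span {w}))
      Ideal.Quotient.mk_surjective, ← hx, Ideal.map_span]
    apply le_antisymm
    · apply Ideal.span_mono
      rintro _ ⟨i, rfl⟩
      exact ⟨_, ⟨_, rfl⟩, rfl⟩
    · rw [Ideal.span_le]
      rintro _ ⟨_, ⟨i, rfl⟩, rfl⟩
      rcases Fin.eq_self_or_eq_succAbove j i with rfl | ⟨k, rfl⟩
      · have h0 : Ideal.Quotient.mk (Ideal.span {w}) w = 0 :=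
          Ideal.Quotient.eq_zero_iff_mem.mpr (Ideal.mem_span_singleton_self w)
        have h1 := congrArg (Ideal.Quotient.mk (Ideal.span {w})) ha
        rw [h0, Fin.sum_univ_succAbove _ i, map_add, map_mul, map_sum] at h1
        have hu : IsUnit (Ideal.Quotient.mk (Ideal.span {w}) (a i)) := hj.map _
        rw [SetLike.mem_coe, ← Ideal.unit_mul_mem_iff_mem _ hu, eq_neg_of_add_eq_zero_left h1]
        refine neg_mem (Ideal.sum_mem _ fun k _ => ?_)
        rw [map_mul]
        exact Ideal.mul_mem_left _ _ (Ideal.subset_span ⟨k, rfl⟩)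
      · exact Ideal.subset_span ⟨k, rfl⟩
  refine ⟨inferInstance, ⟨_, hspan⟩, le_antisymm ?_ ?_⟩
  · refine (ringKrullDim_le_spanFinrank_maximalIdeal _).trans ?_
    rw [← hspan]
    have := Submodule.spanFinrank_span_le_ncard_of_finite (R := R ⧸ Ideal.span {w})
      (Set.finite_range fun i => Ideal.Quotient.mk (Ideal.span {w}) (x (j.succAbove i)))
    have h2 : (Set.range fun i =>
        Ideal.Quotient.mk (Ideal.span {w}) (x (j.succAbove i))).ncard ≤ n := by
      rw [← Nat.card_coe_set_eq]
      simpa using Finite.card_range_le fun i =>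
        Ideal.Quotient.mk (Ideal.span {w}) (x (j.succAbove i))
    exact_mod_cast this.trans h2
  · have h1 := ringKrullDim_le_ringKrullDim_quotient_span_singleton_add_one hw
    rw [h.dim] at h1
    push_cast at h1
    exact ENat.WithBot.add_le_add_natCast_right_iff.mp h1

lemma exists_mem_maximalIdeal_notMem_sq {R : Type u} [CommRing R] [IsNoetherianRing R]
    [IsLocalRing R] (hm : maximalIdeal R ≠ ⊥) {S : Set (Ideal R)} (hS : S.Finite)
    (hp : ∀ p ∈ S, p.IsPrime) (hne : ∀ p ∈ S, p ≠ maximalIdeal R) :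
    ∃ w ∈ maximalIdeal R, w ∉ maximalIdeal R ^ 2 ∧ ∀ p ∈ S, w ∉ p := by
  by_contra! hcon
  have hsub : (maximalIdeal R : Set R) ⊆
      ⋃ i ∈ insert (maximalIdeal R ^ 2) S, ((id i : Ideal R) : Set R) := by
    intro w hw
    simp only [Set.mem_iUnion]
    by_cases h2 : w ∈ maximalIdeal R ^ 2
    · exact ⟨_, Set.mem_insert _ _, h2⟩
    · obtain ⟨p, hp, hwp⟩ := hcon w hw h2
      exact ⟨p, Set.mem_insert_of_mem _ hp, hwp⟩
  rw [Ideal.subset_union_prime_finite (hS.insert _) (maximalIdeal R ^ 2) (maximalIdeal R ^ 2)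
    (by rintro i (rfl | hi) h _ <;> [exact absurd rfl h; exact hp i hi])] at hsub
  obtain ⟨p, rfl | hpS, hle⟩ := hsub
  · apply hm
    rw [eq_bot_iff]
    apply Submodule.le_of_le_smul_of_le_jacobson_bot (I := maximalIdeal R)
      (IsNoetherian.noetherian _) (by rw [IsLocalRing.jacobson_eq_maximalIdeal _ bot_ne_top])
    rw [bot_sup_eq, smul_eq_mul, ← pow_two]
    exact hle
  · exact hne p hpS ((maximalIdeal.isMaximal R).eq_of_le (hp p hpS).ne_top hle).symm

lemma IsRegularLocalOfDim.maximalIdeal_ne_bot {R : Type u} [CommRing R] [IsLocalRing R] {n : ℕ}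
    (h : IsRegularLocalOfDim R (n + 1)) : maximalIdeal R ≠ ⊥ := by
  intro hm
  have h0 := ringKrullDim_eq_zero_of_isField (IsLocalRing.isField_iff_maximalIdeal_eq.mpr hm)
  rw [h.dim] at h0
  have : (n + 1 : ℕ) = 0 := by exact_mod_cast h0
  omega

lemma IsRegularLocalOfDim.isDomain {R : Type u} [CommRing R] [IsLocalRing R] {n : ℕ}
    (h : IsRegularLocalOfDim R n) : IsDomain R := by
  induction n generalizing R with
  | zero =>
    have : (⊥ : Ideal R).IsPrime := h.maximalIdeal_eq_bot ▸ (maximalIdeal.isMaximal R).isPrime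
    exact IsDomain.of_bot_isPrime R
  | succ n ih =>
    have := h.noetherian
    obtain ⟨w, hw, hw2, hwp⟩ := exists_mem_maximalIdeal_notMem_sq h.maximalIdeal_ne_bot
      (minimalPrimes.finite_of_isNoetherianRing R) (fun p hp => hp.1.1) (by
        rintro p hp rfl
        have h1 := (Ideal.height_eq_zero_iff (I := maximalIdeal R)).mpr hp
        have h2 := maximalIdeal_height_eq_ringKrullDim (R := R)
        rw [h1, h.dim] at h2
        have : (n + 1 : ℕ) = 0 := by exact_mod_cast h2.symm
        omega)
    have := isLocalRing_quotient (span_singleton_le_maximalIdeal hw)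
    have := ih (h.quotient hw hw2)
    have hprime : (Ideal.span {w}).IsPrime := (Ideal.Quotient.isDomain_iff_prime _).mp this
    obtain ⟨p, hp, hle⟩ := Ideal.exists_minimalPrimes_le (I := ⊥) (J := Ideal.span {w}) bot_le
    have hpp := hp.1.1
    have hbot : p = ⊥ := by
      rw [eq_bot_iff]
      apply Submodule.le_of_le_smul_of_le_jacobson_bot (I := maximalIdeal R)
        (IsNoetherian.noetherian _) (by rw [IsLocalRing.jacobson_eq_maximalIdeal _ bot_ne_top])
      rw [bot_sup_eq, smul_eq_mul]
      intro a ha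
      obtain ⟨b, rfl⟩ := Ideal.mem_span_singleton'.mp (hle ha)
      rw [mul_comm b w]
      exact Ideal.mul_mem_mul hw ((hpp.mem_or_mem ha).resolve_right (hwp p hp))
    subst hbot
    exact IsDomain.of_bot_isPrime R

/-- `c` is a nonzerodivisor modulo the ideal `J`. -/
def RegularModulo {R : Type u} [CommRing R] (J : Ideal R) (c : R) : Prop :=
  ∀ u, c * u ∈ J → u ∈ J

lemma RegularModulo.iff_isSMulRegular {R : Type u} [CommRing R] {J : Ideal R} {c : R} :
    RegularModulo J c ↔ IsSMulRegular (R ⧸ J) c := by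
  rw [isSMulRegular_iff_right_eq_zero_of_smul, Ideal.Quotient.mk_surjective.forall]
  refine forall_congr' fun u => ?_
  rw [← Ideal.Quotient.eq_zero_iff_mem, ← Ideal.Quotient.eq_zero_iff_mem]
  rfl

/-- `R ⧸ J` admits a regular sequence of length `k` in the maximal ideal. -/
def HasDepth {R : Type u} [CommRing R] [IsLocalRing R] : ℕ → Ideal R → Prop
  | 0, _ => True
  | k + 1, J => ∃ c ∈ maximalIdeal R, RegularModulo J c ∧ HasDepth k (J ⊔ Ideal.span {c})

lemma RegularModulo.comap {R S : Type u} [CommRing R] [CommRing S] {f : R →+* S}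
    {J : Ideal S} {c : R} (h : RegularModulo J (f c)) : RegularModulo (J.comap f) c := by
  intro u hu
  rw [Ideal.mem_comap, map_mul] at hu
  exact h _ hu

lemma HasDepth.comap {R S : Type u} [CommRing R] [CommRing S] [IsLocalRing R] [IsLocalRing S]
    {f : R →+* S} (hf : Function.Surjective f) {k : ℕ} {J : Ideal S} (h : HasDepth k J) :
    HasDepth k (J.comap f) := by
  induction k generalizing J with
  | zero => trivial
  | succ k ih =>
    obtain ⟨c, hc, hreg, hk⟩ := h
    obtain ⟨c, rfl⟩ := hf c
    refine ⟨c, ?_, hreg.comap, ?_⟩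
    · have := hf.isLocalHom f
      rw [mem_maximalIdeal, mem_nonunits_iff] at hc ⊢
      exact fun h => hc (h.map f)
    · have : J.comap f ⊔ Ideal.span {c} = (J ⊔ Ideal.span {f c}).comap f := by
        have h1 : J ⊔ Ideal.span {f c} = (J.comap f ⊔ Ideal.span {c}).map f := by
          rw [Ideal.map_sup, Ideal.map_comap_of_surjective f hf, Ideal.map_span,
            Set.image_singleton]
        rw [h1, Ideal.comap_map_of_surjective f hf, left_eq_sup]
        exact (Ideal.comap_mono bot_le).trans le_sup_left
      rw [this]
      exact ih hk

lemma IsRegularLocalOfDim.hasDepth {R : Type u} [CommRing R] [IsLocalRing R] {n : ℕ}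
    (h : IsRegularLocalOfDim R n) : HasDepth n (⊥ : Ideal R) := by
  induction n generalizing R with
  | zero => trivial
  | succ n ih =>
    have := h.noetherian
    have := h.isDomain
    obtain ⟨w, hw, hw2, -⟩ := exists_mem_maximalIdeal_notMem_sq h.maximalIdeal_ne_bot
      Set.finite_empty (by simp) (by simp)
    have := isLocalRing_quotient (span_singleton_le_maximalIdeal hw)
    refine ⟨w, hw, fun u hu => ?_, ?_⟩
    · have hw0 : w ≠ 0 := fun h0 => hw2 (h0 ▸ zero_mem _)
      simpa [hw0] using hu
    · have := HasDepth.comap (Ideal.Quotient.mk_surjective) (ih (h.quotient hw hw2))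
      rwa [← RingHom.ker_eq_comap_bot, Ideal.mk_ker, ← bot_sup_eq (Ideal.span {w})] at this

lemma exists_prime_of_notMem {R : Type u} [CommRing R] [IsNoetherianRing R] {J : Ideal R} {u : R}
    (hu : u ∉ J) : ∃ p ∈ associatedPrimes R (R ⧸ J), ∀ a, a * u ∈ J → a ∈ p := by
  obtain ⟨p, hp, hle⟩ := exists_le_isAssociatedPrime_of_isNoetherianRing R
    (Ideal.Quotient.mk J u) (by rwa [Ne, Ideal.Quotient.eq_zero_iff_mem])
  refine ⟨p, hp, fun a ha => hle ?_⟩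
  rw [Submodule.mem_colon_singleton, Submodule.mem_bot, Algebra.smul_def,
    Ideal.Quotient.algebraMap_eq, ← map_mul]
  exact Ideal.Quotient.eq_zero_iff_mem.mpr ha

lemma exists_of_mem_associatedPrimes {R : Type u} [CommRing R] [IsNoetherianRing R] {J p : Ideal R}
    (hp : p ∈ associatedPrimes R (R ⧸ J)) : p.IsPrime ∧ ∃ u, ∀ a, a ∈ p ↔ a * u ∈ J := by
  obtain ⟨h1, x, rfl⟩ := isAssociatedPrime_iff.mp hp
  obtain ⟨u, rfl⟩ := Ideal.Quotient.mk_surjective x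
  refine ⟨h1, u, fun a => ?_⟩
  rw [Submodule.mem_colon_singleton, Submodule.mem_bot, Algebra.smul_def,
    Ideal.Quotient.algebraMap_eq, ← map_mul]
  exact Ideal.Quotient.eq_zero_iff_mem

/-- `R ⧸ J` has zero socle. -/
def SocleFree {R : Type u} [CommRing R] [IsLocalRing R] (J : Ideal R) : Prop :=
  ∀ u, (∀ x ∈ maximalIdeal R, x * u ∈ J) → u ∈ J

lemma HasDepth.socleFree {R : Type u} [CommRing R] [IsLocalRing R] {J : Ideal R} {k : ℕ}
    (h : HasDepth (k + 1) J) : SocleFree J := by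
  obtain ⟨c, hc, hreg, -⟩ := h
  exact fun u hu => hreg u (hu c hc)

lemma regularModulo_of_forall_notMem {R : Type u} [CommRing R] [IsNoetherianRing R] {J : Ideal R}
    {c : R} (h : ∀ p ∈ associatedPrimes R (R ⧸ J), c ∉ p) : RegularModulo J c := by
  intro u hu
  by_contra hJ
  obtain ⟨p, hp, hp2⟩ := exists_prime_of_notMem hJ
  exact h p hp (hp2 c hu)

lemma SocleFree.ne_maximalIdeal {R : Type u} [CommRing R] [IsNoetherianRing R] [IsLocalRing R]
    {J : Ideal R} (hJ : SocleFree J) {p : Ideal R} (hp : p ∈ associatedPrimes R (R ⧸ J)) :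
    p ≠ maximalIdeal R := by
  rintro rfl
  obtain ⟨h1, u, hu⟩ := exists_of_mem_associatedPrimes hp
  have := hJ u fun x hx => (hu x).mp hx
  exact h1.ne_top ((Ideal.eq_top_iff_one _).mpr ((hu 1).mpr (by simpa using this)))

lemma exists_regularModulo {R : Type u} [CommRing R] [IsNoetherianRing R] [IsLocalRing R]
    {T : Set (Ideal R)} (hT : T.Finite) (h : ∀ J ∈ T, SocleFree J) :
    ∃ c ∈ maximalIdeal R, ∀ J ∈ T, RegularModulo J c := by
  by_contra! hcon
  have hfin : (⋃ J ∈ T, associatedPrimes R (R ⧸ J)).Finite :=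
    hT.biUnion fun J _ => associatedPrimes.finite R _
  have hsub : (maximalIdeal R : Set R) ⊆
      ⋃ p ∈ ⋃ J ∈ T, associatedPrimes R (R ⧸ J), ((id p : Ideal R) : Set R) := by
    intro c hc
    obtain ⟨J, hJ, hcJ⟩ := hcon c hc
    have := mt regularModulo_of_forall_notMem hcJ
    push Not at this
    obtain ⟨p, hp, hcp⟩ := this
    simp only [Set.mem_iUnion]
    exact ⟨p, ⟨J, hJ, hp⟩, hcp⟩
  have hprime : ∀ p ∈ ⋃ J ∈ T, associatedPrimes R (R ⧸ J), p.IsPrime := by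
    simp only [Set.mem_iUnion]
    rintro p ⟨J, -, hp⟩
    exact hp.isPrime
  rw [Ideal.subset_union_prime_finite hfin (f := id) ⊥ ⊥ (fun p hp _ _ => hprime p hp)] at hsub
  obtain ⟨p, hp, hle⟩ := hsub
  have := ((maximalIdeal.isMaximal R).eq_of_le (hprime p hp).ne_top hle).symm
  simp only [Set.mem_iUnion] at hp
  obtain ⟨J, hJ, hp⟩ := hp
  exact (h J hJ).ne_maximalIdeal hp this

lemma mem_sup_span_singleton_iff {R : Type u} [CommRing R] {J : Ideal R} {a u : R} :
    u ∈ J ⊔ Ideal.span {a} ↔ ∃ v, u - a * v ∈ J := by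
  rw [sup_comm, Ideal.mem_span_singleton_sup]
  constructor
  · rintro ⟨v, j, hj, rfl⟩
    exact ⟨v, by convert hj using 1; ring⟩
  · rintro ⟨v, hv⟩
    exact ⟨v, _, hv, by ring⟩

lemma RegularModulo.swap {R : Type u} [CommRing R] {J : Ideal R} {a c : R}
    (ha : RegularModulo J a) (hc : RegularModulo (J ⊔ Ideal.span {a}) c) :
    RegularModulo (J ⊔ Ideal.span {c}) a := by
  intro u hu
  obtain ⟨v, hv⟩ := mem_sup_span_singleton_iff.mp hu
  have h1 : c * v ∈ J ⊔ Ideal.span {a} := by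
    refine mem_sup_span_singleton_iff.mpr ⟨u, ?_⟩
    rw [← neg_mem_iff]
    convert hv using 1; ring
  obtain ⟨t, ht⟩ := mem_sup_span_singleton_iff.mp (hc v h1)
  refine mem_sup_span_singleton_iff.mpr ⟨t, ha _ ?_⟩
  convert add_mem hv (J.mul_mem_left c ht) using 1; ring

lemma SocleFree.exchange {R : Type u} [CommRing R] [IsLocalRing R] {J : Ideal R} {a b : R}
    (hb : b ∈ maximalIdeal R) (hJa : RegularModulo J a) (hJb : RegularModulo J b)
    (h : SocleFree (J ⊔ Ideal.span {b})) :
    SocleFree (J ⊔ Ideal.span {a}) := by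
  intro u hu
  obtain ⟨t, ht⟩ := mem_sup_span_singleton_iff.mp (hu b hb)
  have h1 : t ∈ J ⊔ Ideal.span {b} := by
    refine h t fun x hx => ?_
    obtain ⟨v, hv⟩ := mem_sup_span_singleton_iff.mp (hu x hx)
    refine mem_sup_span_singleton_iff.mpr ⟨v, hJa _ ?_⟩
    convert sub_mem (J.mul_mem_left b hv) (J.mul_mem_left x ht) using 1; ring
  obtain ⟨v, hv⟩ := mem_sup_span_singleton_iff.mp h1
  refine mem_sup_span_singleton_iff.mpr ⟨v, hJb _ ?_⟩
  convert add_mem ht (J.mul_mem_left a hv) using 1; ring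

lemma HasDepth.exchange {R : Type u} [CommRing R] [IsNoetherianRing R] [IsLocalRing R]
    {J : Ideal R} {a : R} {k : ℕ} (h : HasDepth (k + 1) J) (ha : a ∈ maximalIdeal R)
    (hJa : RegularModulo J a) : HasDepth k (J ⊔ Ideal.span {a}) := by
  induction k generalizing J a with
  | zero => trivial
  | succ k ih =>
    have hJ := h.socleFree
    obtain ⟨b, hb, hJb, hk⟩ := h
    have hJbS := hk.socleFree
    have hJaS := hJbS.exchange hb hJa hJb
    obtain ⟨c, hc, hreg⟩ := exists_regularModulo
      (T := {J, J ⊔ Ideal.span {a}, J ⊔ Ideal.span {b}}) (Set.toFinite _)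
      (by rintro _ (rfl | rfl | rfl) <;> assumption)
    have hcJ := hreg J (by simp)
    have hca := hreg (J ⊔ Ideal.span {a}) (by simp)
    have hcb := hreg (J ⊔ Ideal.span {b}) (by simp)
    refine ⟨c, hc, hca, ?_⟩
    rw [sup_right_comm]
    refine ih ⟨b, hb, hJb.swap hcb, ?_⟩ ha (hJa.swap hca)
    rw [sup_right_comm]
    exact ih hk hc hcb

lemma ringKrullDim_quotient_succ_le_of_mem {R : Type u} [CommRing R] {p q : Ideal R}
    (hp : p.IsPrime) (hle : p ≤ q) {w : R} (hw : w ∈ q) (hwp : w ∉ p) :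
    ringKrullDim (R ⧸ q) + 1 ≤ ringKrullDim (R ⧸ p) := by
  refine ringKrullDim_succ_le_of_surjective (Ideal.Quotient.factor hle)
    (Ideal.Quotient.factor_surjective hle) (r := Ideal.Quotient.mk p w) ?_ ?_
  · rw [mem_nonZeroDivisors_iff_ne_zero, Ne, Ideal.Quotient.eq_zero_iff_mem]
    exact hwp
  · rw [Ideal.Quotient.factor_mk]
    exact Ideal.Quotient.eq_zero_iff_mem.mpr hw

lemma HasDepth.le_ringKrullDim {R : Type u} [CommRing R] [IsNoetherianRing R] [IsLocalRing R]
    {J p : Ideal R} {k : ℕ} (h : HasDepth k J) (hp : p ∈ associatedPrimes R (R ⧸ J)) :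
    (k : WithBot ℕ∞) ≤ ringKrullDim (R ⧸ p) := by
  induction k generalizing J p with
  | zero =>
    have := hp.isPrime
    have : Nontrivial (R ⧸ p) := inferInstance
    exact ringKrullDim_nonneg_of_nontrivial
  | succ k ih =>
    obtain ⟨w, hw, hJw, hk⟩ := h
    obtain ⟨hpp, u, hu⟩ := exists_of_mem_associatedPrimes hp
    have huJ : u ∉ J := fun h => hpp.ne_top
      ((Ideal.eq_top_iff_one _).mpr ((hu 1).mpr (by simpa using h)))
    have hwp : w ∉ p := fun h => huJ (hJw u ((hu w).mp h))
    obtain ⟨v, hv, hvJ⟩ : ∃ v, (∀ a ∈ p, a * v ∈ J) ∧ v ∉ J ⊔ Ideal.span {w} := by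
      by_contra! hcon
      let N : Ideal R :=
        { carrier := {v | ∀ a ∈ p, a * v ∈ J}
          add_mem' := fun hx hy a ha => by rw [mul_add]; exact add_mem (hx a ha) (hy a ha)
          zero_mem' := fun a _ => by rw [mul_zero]; exact zero_mem _
          smul_mem' := fun c x hx a ha => by
            rw [smul_eq_mul, mul_left_comm]; exact J.mul_mem_left _ (hx a ha) }
      have hN : N ≤ J := by
        apply Submodule.le_of_le_smul_of_le_jacobson_bot (I := maximalIdeal R)
          (IsNoetherian.noetherian _) (by rw [IsLocalRing.jacobson_eq_maximalIdeal _ bot_ne_top])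
        intro v hv
        obtain ⟨t, ht⟩ := mem_sup_span_singleton_iff.mp (hcon v hv)
        have htN : t ∈ N := fun a ha => hJw _ (by
          convert sub_mem (hv a ha) (J.mul_mem_left a ht) using 1; ring)
        have := add_mem (Submodule.mem_sup_left ht)
          (Submodule.mem_sup_right (Ideal.mul_mem_mul hw htN))
        rwa [sub_add_cancel] at this
      exact huJ (hN fun a ha => (hu a).mp ha)
    obtain ⟨q, hq, hqv⟩ := exists_prime_of_notMem hvJ
    have h1 := ih hk hq
    refine le_trans ?_ (ringKrullDim_quotient_succ_le_of_mem hpp (q := q) (w := w)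
      (fun a ha => hqv a (Ideal.mem_sup_left (hv a ha)))
      (hqv w (Ideal.mem_sup_right (Ideal.mul_mem_right _ _ (Ideal.mem_span_singleton_self w)))) hwp)
    push_cast
    gcongr

lemma length_le_ringKrullDim_localization {R : Type u} [CommRing R] [IsNoetherianRing R]
    {P : Ideal R} [P.IsPrime] {rs : List R}
    (h : RingTheory.Sequence.IsWeaklyRegular R rs) (hrs : ∀ r ∈ rs, r ∈ P) :
    (rs.length : WithBot ℕ∞) ≤ ringKrullDim (Localization.AtPrime P) := by
  have h1 : RingTheory.Sequence.IsWeaklyRegular (Localization.AtPrime P)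
      (rs.map (algebraMap R (Localization.AtPrime P))) := h.of_flat
  have hmem : Ideal.ofList (rs.map (algebraMap R (Localization.AtPrime P)))
      ≤ maximalIdeal (Localization.AtPrime P) := by
    rw [Ideal.ofList, Ideal.span_le]
    intro x hx
    simp only [List.mem_map, Set.mem_ofPred_eq] at hx
    obtain ⟨r, hr, rfl⟩ := hx
    exact (IsLocalization.AtPrime.to_map_mem_maximal_iff (Localization.AtPrime P) P r).mpr
      (hrs r hr)
  have hreg : RingTheory.Sequence.IsRegular (Localization.AtPrime P)
      (rs.map (algebraMap R (Localization.AtPrime P))) := by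
    refine ⟨h1, fun htop => (maximalIdeal.isMaximal (Localization.AtPrime P)).ne_top ?_⟩
    rw [eq_top_iff, htop, smul_eq_mul]
    exact Ideal.mul_le_left.trans hmem
  have h2 := ringKrullDim_add_length_eq_ringKrullDim_of_isRegular _ hreg
  rw [← h2, List.length_map]
  have := isLocalRing_quotient hmem
  exact le_add_of_nonneg_left ringKrullDim_nonneg_of_nontrivial

lemma exists_le_height_le_ringKrullDim_quotient {R : Type u} [CommRing R] [IsNoetherianRing R]
    [IsLocalRing R] {P : Ideal R} [P.IsPrime] {k : ℕ} {rs : List R}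
    (h : RingTheory.Sequence.IsWeaklyRegular R rs) (hrs : ∀ r ∈ rs, r ∈ P)
    (hk : HasDepth k (Ideal.ofList rs)) :
    ∃ t l : ℕ, rs.length + k = t + l ∧
      (t : WithBot ℕ∞) ≤ ringKrullDim (Localization.AtPrime P) ∧
      (l : WithBot ℕ∞) ≤ ringKrullDim (R ⧸ P) := by
  induction k generalizing rs with
  | zero =>
    exact ⟨rs.length, 0, rfl, length_le_ringKrullDim_localization h hrs,
      ringKrullDim_nonneg_of_nontrivial⟩
  | succ k ih =>
    by_cases hex : ∃ a ∈ P, RegularModulo (Ideal.ofList rs) a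
    · obtain ⟨a, haP, ha⟩ := hex
      have h1 : RingTheory.Sequence.IsWeaklyRegular R (rs ++ [a]) := by
        rw [RingTheory.Sequence.isWeaklyRegular_append_iff]
        refine ⟨h, ?_⟩
        rw [RingTheory.Sequence.isWeaklyRegular_singleton_iff]
        have := RegularModulo.iff_isSMulRegular.mp ha
        rwa [smul_eq_mul, Ideal.mul_top]
      obtain ⟨t, l, htl, ht, hl⟩ := ih h1
        (by simpa [or_imp, forall_and] using ⟨hrs, haP⟩) (by
          rw [Ideal.ofList_append, Ideal.ofList_singleton]
          exact hk.exchange (le_maximalIdeal (Ideal.IsPrime.ne_top inferInstance) haP) ha)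
      refine ⟨t, l, ?_, ht, hl⟩
      simp only [List.length_append, List.length_singleton] at htl
      omega
    · have hfin := associatedPrimes.finite R (R ⧸ Ideal.ofList rs)
      have hsub : (P : Set R) ⊆ ⋃ p ∈ associatedPrimes R (R ⧸ Ideal.ofList rs),
          ((id p : Ideal R) : Set R) := by
        intro c hc
        have := mt regularModulo_of_forall_notMem (fun h => hex ⟨c, hc, h⟩)
        push Not at this
        obtain ⟨p, hp, hcp⟩ := this
        simp only [Set.mem_iUnion]
        exact ⟨p, hp, hcp⟩
      rw [Ideal.subset_union_prime_finite hfin (f := id) ⊥ ⊥ (fun p hp _ _ => hp.isPrime)] at hsub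
      obtain ⟨p, hp, hle⟩ := hsub
      refine ⟨rs.length, k + 1, rfl, length_le_ringKrullDim_localization h hrs,
        (hk.le_ringKrullDim hp).trans ?_⟩
      exact ringKrullDim_le_of_surjective (Ideal.Quotient.factor hle)
        (Ideal.Quotient.factor_surjective hle)

lemma IsRegularLocalOfDim.le_ringKrullDim_quotient {R : Type u} [CommRing R] [IsLocalRing R]
    {n d : ℕ} (h : IsRegularLocalOfDim R n) {P : Ideal R} [P.IsPrime]
    (hd : ringKrullDim (Localization.AtPrime P) = d) :
    ∃ l : ℕ, n ≤ d + l ∧ (l : WithBot ℕ∞) ≤ ringKrullDim (R ⧸ P) := by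
  have := h.noetherian
  obtain ⟨t, l, htl, ht, hl⟩ := exists_le_height_le_ringKrullDim_quotient
    (RingTheory.Sequence.IsWeaklyRegular.nil R R) (P := P) (by simp)
    (by rw [Ideal.ofList_nil]; exact h.hasDepth)
  rw [hd] at ht
  have ht' : t ≤ d := by exact_mod_cast ht
  simp only [List.length_nil] at htl
  exact ⟨l, by omega, hl⟩

lemma ringKrullDim_localization_add_ringKrullDim_quotient_le {R : Type u} [CommRing R]
    (Q : Ideal R) [Q.IsPrime] :
    ringKrullDim (Localization.AtPrime Q) + ringKrullDim (R ⧸ Q) ≤ ringKrullDim R := by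
  have h1 : (PrimeSpectrum.zeroLocus (R := R) Q) =
      Set.Ici (⟨Q, inferInstance⟩ : PrimeSpectrum R) := by
    ext p
    simp [PrimeSpectrum.mem_zeroLocus, ← PrimeSpectrum.asIdeal_le_asIdeal]
  have : Nonempty (PrimeSpectrum R) := ⟨⟨Q, inferInstance⟩⟩
  rw [IsLocalization.AtPrime.ringKrullDim_eq_height Q, ringKrullDim_quotient, h1,
    ← Order.coheight_eq_krullDim_Ici,
    (⟨Q, inferInstance⟩ : PrimeSpectrum R).height_eq_orderHeight, ringKrullDim,
    Order.krullDim_eq_iSup_height_add_coheight_of_nonempty]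
  exact_mod_cast le_iSup (fun p : PrimeSpectrum R => Order.height p + Order.coheight p) _

lemma exists_nat_ringKrullDim_localization_eq {R : Type u} [CommRing R] {Q : Ideal R} [Q.IsPrime]
    {b n : ℕ} (hR : ringKrullDim R = n) (hQ : (b : WithBot ℕ∞) ≤ ringKrullDim (R ⧸ Q)) :
    ∃ a : ℕ, ringKrullDim (Localization.AtPrime Q) = a ∧ a + b ≤ n := by
  have h := ringKrullDim_localization_add_ringKrullDim_quotient_le Q
  rw [hR] at h
  have h2 : ringKrullDim (Localization.AtPrime Q) + b ≤ n := le_trans (by gcongr) h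
  rw [IsLocalization.AtPrime.ringKrullDim_eq_height Q] at h2 ⊢
  have h3 : Q.height + b ≤ (n : ℕ∞) := by exact_mod_cast h2
  obtain ⟨a, ha⟩ := ENat.ne_top_iff_exists.mp
    (ne_top_of_le_ne_top (ENat.natCast_ne_top n) (le_self_add.trans h3))
  rw [← ha] at h3 ⊢
  exact ⟨a, rfl, by exact_mod_cast h3⟩

lemma exists_isPrime_le_ringKrullDim_quotient {R : Type u} [CommRing R] {l : ℕ}
    (h : (l : WithBot ℕ∞) ≤ ringKrullDim R) :
    ∃ P : Ideal R, P.IsPrime ∧ (l : WithBot ℕ∞) ≤ ringKrullDim (R ⧸ P) := by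
  obtain ⟨p, hp⟩ := Order.le_krullDim_iff.mp h
  refine ⟨p.head.asIdeal, p.head.isPrime, ?_⟩
  have h1 : (PrimeSpectrum.zeroLocus (R := R) p.head.asIdeal) = Set.Ici p.head := by
    ext q
    simp [PrimeSpectrum.mem_zeroLocus, ← PrimeSpectrum.asIdeal_le_asIdeal]
  rw [ringKrullDim_quotient, h1, ← Order.coheight_eq_krullDim_Ici, ← hp]
  exact_mod_cast Order.length_le_coheight_head

lemma ringKrullDim_quotient_le_quotient_comap {R S : Type u} [CommRing R] [CommRing S]
    {f : R →+* S} (hf : Function.Surjective f) (J : Ideal S) :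
    ringKrullDim (S ⧸ J) ≤ ringKrullDim (R ⧸ J.comap f) :=
  ringKrullDim_le_of_surjective (Ideal.quotientMap J f le_rfl)
    (Ideal.quotientMap_surjective hf)

lemma exists_isPrime_map_le {R S : Type u} [CommRing R] [CommRing S] {f : R →+* S}
    {P : Ideal R} {l : ℕ}
    (h : (l : WithBot ℕ∞) ≤ ringKrullDim (S ⧸ P.map f)) :
    ∃ Q : Ideal S, Q.IsPrime ∧ P.map f ≤ Q ∧ (l : WithBot ℕ∞) ≤ ringKrullDim (S ⧸ Q) := by
  obtain ⟨Q, hQ, hl⟩ := exists_isPrime_le_ringKrullDim_quotient h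
  refine ⟨Q.comap (Ideal.Quotient.mk _), hQ.comap _, ?_,
    hl.trans (ringKrullDim_quotient_le_quotient_comap Ideal.Quotient.mk_surjective Q)⟩
  exact (Ideal.mk_ker (I := P.map f)).symm.le.trans (Ideal.comap_mono bot_le)

lemma IsRegularLocalOfDim.exists_prime_of_mem {R : Type u} [CommRing R] [IsLocalRing R]
    {n d : ℕ} (h : IsRegularLocalOfDim R (n + 1)) {w : R} (hw : w ∈ maximalIdeal R)
    (hw2 : w ∉ maximalIdeal R ^ 2) {P : Ideal R} [P.IsPrime] (hwP : w ∈ P)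
    (hd : ringKrullDim (Localization.AtPrime P) = d) :
    ∃ (Q : Ideal (R ⧸ Ideal.span {w})) (_ : Q.IsPrime) (e : ℕ),
      P.map (Ideal.Quotient.mk _) ≤ Q ∧ ringKrullDim (Localization.AtPrime Q) = e ∧
        e + 1 ≤ d := by
  have := isLocalRing_quotient (span_singleton_le_maximalIdeal hw)
  obtain ⟨l, hl, hl2⟩ := h.le_ringKrullDim_quotient hd
  have hle : Ideal.span {w} ≤ P := (Ideal.span_singleton_le_iff_mem _).mpr hwP
  obtain ⟨Q, hQ, hPQ, hQl⟩ := exists_isPrime_map_le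
    (f := Ideal.Quotient.mk (Ideal.span {w})) (P := P)
    (hl2.trans (ringKrullDim_eq_of_ringEquiv (DoubleQuot.quotQuotEquivQuotOfLE hle)).ge)
  obtain ⟨e, he, hen⟩ := exists_nat_ringKrullDim_localization_eq (h.quotient hw hw2).dim hQl
  exact ⟨Q, hQ, e, hPQ, he, by omega⟩

lemma IsRegularLocalOfDim.exists_prime {R : Type u} [CommRing R] [IsLocalRing R]
    {n d : ℕ} (h : IsRegularLocalOfDim R (n + 1)) {w : R} (hw : w ∈ maximalIdeal R)
    (hw2 : w ∉ maximalIdeal R ^ 2) {P : Ideal R} [P.IsPrime]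
    (hd : ringKrullDim (Localization.AtPrime P) = d) :
    ∃ (Q : Ideal (R ⧸ Ideal.span {w})) (_ : Q.IsPrime) (e : ℕ),
      P.map (Ideal.Quotient.mk _) ≤ Q ∧ ringKrullDim (Localization.AtPrime Q) = e ∧
        e ≤ d := by
  have := h.noetherian
  have := isLocalRing_quotient (span_singleton_le_maximalIdeal hw)
  have := isLocalRing_quotient (le_maximalIdeal (Ideal.IsPrime.ne_top (I := P) inferInstance))
  obtain ⟨l, hl, hl2⟩ := h.le_ringKrullDim_quotient hd
  have hwm : Ideal.Quotient.mk P w ∈ maximalIdeal (R ⧸ P) := by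
    rw [← map_maximalIdeal_of_surjective (Ideal.Quotient.mk P) Ideal.Quotient.mk_surjective]
    exact Ideal.mem_map_of_mem _ hw
  have := isLocalRing_quotient (span_singleton_le_maximalIdeal hwm)
  have h1 := hl2.trans (ringKrullDim_le_ringKrullDim_quotient_span_singleton_add_one hwm)
  have h2 : ((l - 1 : ℕ) : WithBot ℕ∞) ≤
      ringKrullDim ((R ⧸ Ideal.span {w}) ⧸ P.map (Ideal.Quotient.mk (Ideal.span {w}))) := by
    rw [ringKrullDim_eq_of_ringEquiv (DoubleQuot.quotQuotEquivComm (Ideal.span {w}) P),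
      Ideal.map_span, Set.image_singleton]
    cases l with
    | zero => exact ringKrullDim_nonneg_of_nontrivial
    | succ l =>
      push_cast at h1
      exact ENat.WithBot.add_le_add_natCast_right_iff.mp h1
  obtain ⟨Q, hQ, hPQ, hQl⟩ := exists_isPrime_map_le
    (f := Ideal.Quotient.mk (Ideal.span {w})) h2
  obtain ⟨e, he, hen⟩ := exists_nat_ringKrullDim_localization_eq (h.quotient hw hw2).dim hQl
  exact ⟨Q, hQ, e, hPQ, he, by omega⟩

/-- `0 → N → F → C → 0` is exact with `F` finitely generated free. -/
structure IsFreeSES {R N F C : Type u} [CommRing R] [AddCommGroup N] [Module R N]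
    [AddCommGroup F] [Module R F] [AddCommGroup C] [Module R C]
    (f : N →ₗ[R] F) (g : F →ₗ[R] C) : Prop where
  free : Module.Free R F
  finite : Module.Finite R F
  injective : Function.Injective f
  surjective : Function.Surjective g
  exact : Function.Exact f g

/-- `N` is a `k`-th syzygy of a module on which `w` is a nonzerodivisor. -/
def IsSyzygyOf {R : Type u} [CommRing R] (w : R) : ℕ → (N : Type u) → [AddCommGroup N] →
    [Module R N] → Prop
  | 0, N, _, _ => IsSMulRegular N w
  | k + 1, N, _, _ => ∃ (F C : Type u) (_ : AddCommGroup F) (_ : Module R F) (_ : AddCommGroup C)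
      (_ : Module R C) (f : N →ₗ[R] F) (g : F →ₗ[R] C), IsFreeSES f g ∧ IsSyzygyOf w k C

lemma IsFreeSES.isSyzygyOf {R N F C : Type u} [CommRing R] [AddCommGroup N] [Module R N]
    [AddCommGroup F] [Module R F] [AddCommGroup C] [Module R C]
    {f : N →ₗ[R] F} {g : F →ₗ[R] C} (h : IsFreeSES f g) {w : R} {k : ℕ} (hC : IsSyzygyOf w k C) :
    IsSyzygyOf w (k + 1) N :=
  ⟨F, C, _, _, _, _, f, g, h, hC⟩

lemma isSyzygyOf_one_zero {R : Type u} [CommRing R] (N : Type u) [AddCommGroup N] [Module R N] :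
    IsSyzygyOf (1 : R) 0 N :=
  IsSMulRegular.one N

lemma IsSyzygyOf.one {R : Type u} [CommRing R] {w : R} {k : ℕ} {N : Type u} [AddCommGroup N]
    [Module R N] (h : IsSyzygyOf w k N) : IsSyzygyOf (1 : R) k N := by
  induction k generalizing N with
  | zero => exact isSyzygyOf_one_zero N
  | succ k ih =>
    obtain ⟨F, C, _, _, _, _, f, g, hfg, hC⟩ := h
    exact hfg.isSyzygyOf (ih hC)

lemma IsSyzygyOf.pred {R : Type u} [CommRing R] {k : ℕ} {N : Type u} [AddCommGroup N]
    [Module R N] (h : IsSyzygyOf (1 : R) (k + 1) N) : IsSyzygyOf (1 : R) k N := by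
  induction k generalizing N with
  | zero => exact isSyzygyOf_one_zero N
  | succ k ih =>
    obtain ⟨F, C, _, _, _, _, f, g, hfg, hC⟩ := h
    exact hfg.isSyzygyOf (ih hC)

lemma IsFreeSES.isSMulRegular {R N F C : Type u} [CommRing R] [AddCommGroup N] [Module R N]
    [AddCommGroup F] [Module R F] [AddCommGroup C] [Module R C]
    {f : N →ₗ[R] F} {g : F →ₗ[R] C} (h : IsFreeSES f g) {w : R} (hw : IsSMulRegular R w) :
    IsSMulRegular N w := by
  have := h.free
  have hw' : w ∈ nonZeroDivisors R := mem_nonZeroDivisors_iff_right.mpr fun x hx =>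
    (isSMulRegular_iff_right_eq_zero_of_smul.mp hw) x (by rwa [smul_eq_mul, mul_comm])
  exact (Module.Flat.isSMulRegular_of_nonZeroDivisors hw').of_injective f h.injective

lemma IsSyzygyOf.of_isSMulRegular {R : Type u} [CommRing R] {w : R} (hw : IsSMulRegular R w)
    {k : ℕ} {N : Type u} [AddCommGroup N] [Module R N] (h : IsSyzygyOf (1 : R) (k + 1) N) :
    IsSyzygyOf w k N := by
  induction k generalizing N with
  | zero =>
    obtain ⟨F, C, _, _, _, _, f, g, hfg, hC⟩ := h
    exact hfg.isSMulRegular hw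
  | succ k ih =>
    obtain ⟨F, C, _, _, _, _, f, g, hfg, hC⟩ := h
    exact hfg.isSyzygyOf (ih hC)

lemma IsSyzygyOf.isSMulRegular {R : Type u} [CommRing R] {w : R} (hw : IsSMulRegular R w)
    {k : ℕ} {N : Type u} [AddCommGroup N] [Module R N] (h : IsSyzygyOf w k N) :
    IsSMulRegular N w := by
  cases k with
  | zero => exact h
  | succ k =>
    obtain ⟨F, C, _, _, _, _, f, g, hfg, hC⟩ := h
    exact hfg.isSMulRegular hw

/-- The map `M ⧸ wM → N ⧸ wN` as a linear map over `R ⧸ (w)`. -/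
noncomputable def quotMap {R M N : Type u} [CommRing R] [AddCommGroup M] [Module R M]
    [AddCommGroup N] [Module R N] (w : R) (f : M →ₗ[R] N) :
    QuotSMulTop w M →ₗ[R ⧸ Ideal.span {w}] QuotSMulTop w N :=
  LinearMap.extendScalarsOfSurjective (Ideal.Quotient.mk_surjective) (QuotSMulTop.map w f)

lemma finite_quotSMulTop {R M : Type u} [CommRing R] [AddCommGroup M] [Module R M] (w : R)
    [Module.Finite R M] : Module.Finite (R ⧸ Ideal.span {w}) (QuotSMulTop w M) :=
  have : Module.Finite R (QuotSMulTop w M) := inferInstance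
  Module.Finite.of_restrictScalars_finite R _ _

lemma free_quotSMulTop {R M : Type u} [CommRing R] [AddCommGroup M] [Module R M] (w : R)
    [Module.Free R M] : Module.Free (R ⧸ Ideal.span {w}) (QuotSMulTop w M) :=
  inferInstance

lemma IsFreeSES.quotMap {R N F C : Type u} [CommRing R] [AddCommGroup N] [Module R N]
    [AddCommGroup F] [Module R F] [AddCommGroup C] [Module R C]
    {f : N →ₗ[R] F} {g : F →ₗ[R] C} (h : IsFreeSES f g) {w : R} (hw : IsSMulRegular C w) :
    IsFreeSES (quotMap w f) (quotMap w g) := by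
  have := h.free
  have := h.finite
  refine ⟨free_quotSMulTop w, finite_quotSMulTop w, ?_, QuotSMulTop.map_surjective w h.surjective,
    QuotSMulTop.map_exact w h.exact h.surjective⟩
  have hz : Function.Exact (0 : N →ₗ[R] N) f := by
    rw [LinearMap.exact_iff, LinearMap.ker_eq_bot.mpr h.injective, LinearMap.range_zero]
  have := QuotSMulTop.map_first_exact_on_four_term_exact_of_isSMulRegular_last hz h.exact hw
  rw [LinearMap.exact_iff, map_zero, LinearMap.range_zero, LinearMap.ker_eq_bot] at this
  exact this

lemma IsSyzygyOf.quotSMulTop {R : Type u} [CommRing R] {w : R} (hw : IsSMulRegular R w)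
    {k : ℕ} {N : Type u} [AddCommGroup N] [Module R N] (h : IsSyzygyOf w k N) :
    IsSyzygyOf (1 : R ⧸ Ideal.span {w}) k (QuotSMulTop w N) := by
  induction k generalizing N with
  | zero => exact isSyzygyOf_one_zero _
  | succ k ih =>
    obtain ⟨F, C, _, _, _, _, f, g, hfg, hC⟩ := h
    exact (hfg.quotMap (hC.isSMulRegular hw)).isSyzygyOf (ih hC)

lemma free_of_forall_mem_smul_top {R N F C : Type u} [CommRing R] [IsLocalRing R]
    [AddCommGroup N] [Module R N] [AddCommGroup F] [Module R F] [AddCommGroup C] [Module R C]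
    {f : N →ₗ[R] F} {g : F →ₗ[R] C} (h : IsFreeSES f g) [Module.Finite R N]
    (hf : ∀ x, f x ∈ maximalIdeal R • (⊤ : Submodule R F) →
      x ∈ maximalIdeal R • (⊤ : Submodule R N)) : Module.Free R C := by
  have := h.free
  have := h.finite
  refine Module.free_of_lTensor_residueField_injective f g h.surjective h.exact ?_
  rw [injective_iff_map_eq_zero]
  intro z hz
  obtain ⟨x, rfl⟩ := TensorProduct.mk_surjective R N (ResidueField R)
    Ideal.Quotient.mk_surjective z
  rw [TensorProduct.mk_apply, LinearMap.lTensor_tmul] at hz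
  have h1 := congrArg (TensorProduct.quotTensorEquivQuotSMul F (maximalIdeal R)) hz
  have h2 : TensorProduct.quotTensorEquivQuotSMul F (maximalIdeal R)
      (TensorProduct.tmul R 1 (f x)) = 0 :=
    h1.trans (map_zero _)
  rw [TensorProduct.quotTensorEquivQuotSMul_mk_one_tmul, Submodule.Quotient.mk_eq_zero] at h2
  have h3 : TensorProduct.quotTensorEquivQuotSMul N (maximalIdeal R)
      (TensorProduct.tmul R 1 x) = 0 := by
    rw [TensorProduct.quotTensorEquivQuotSMul_mk_one_tmul, Submodule.Quotient.mk_eq_zero]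
    exact hf x h2
  exact (LinearEquiv.map_eq_zero_iff _).mp h3

lemma mem_smul_top_of_smul_eq_zero {R N : Type u} [CommRing R] [IsLocalRing R]
    [AddCommGroup N] [Module R N] [Module.Free R N] [Module.Finite R N] {c : R} (hc : c ≠ 0)
    {x : N} (hx : c • x = 0) : x ∈ maximalIdeal R • (⊤ : Submodule R N) := by
  let b := Module.Free.chooseBasis R N
  rw [← b.sum_repr x]
  refine Submodule.sum_mem _ fun i _ => Submodule.smul_mem_smul ?_ trivial
  rw [mem_maximalIdeal, mem_nonunits_iff]
  intro hu
  have h1 : c * b.repr x i = 0 := by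
    have := congrArg (fun y => b.repr y i) hx
    simpa using this
  exact hc ((hu.mul_left_eq_zero).mp h1)

lemma smul_eq_zero_of_mem_smul_top {R N : Type u} [CommRing R] [AddCommGroup N] [Module R N]
    {I : Ideal R} {c : R} (hc : ∀ a ∈ I, a * c = 0) {x : N} (hx : x ∈ I • (⊤ : Submodule R N)) :
    c • x = 0 := by
  induction hx using Submodule.smul_induction_on' with
  | smul a ha y _ => rw [smul_smul, mul_comm, hc a ha, zero_smul]
  | add y _ z _ hy hz => rw [smul_add, hy, hz, add_zero]

lemma RegularModulo.isSMulRegular_of_bot {R : Type u} [CommRing R] {x : R}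
    (h : RegularModulo (⊥ : Ideal R) x) : IsSMulRegular R x :=
  isSMulRegular_iff_right_eq_zero_of_smul.mpr fun u hu => h u hu

lemma IsSyzygyOf.free_of_isFreeSES {R : Type u} [CommRing R] [IsLocalRing R]
    [IsNoetherianRing R] {e : ℕ} (hR : ringKrullDim R ≤ e) {N F C : Type u} [AddCommGroup N]
    [Module R N] [AddCommGroup F] [Module R F] [AddCommGroup C] [Module R C]
    {f : N →ₗ[R] F} {g : F →ₗ[R] C} (h : IsFreeSES f g) (hN : Module.Free R N)
    (hNf : Module.Finite R N) (hC : IsSyzygyOf (1 : R) e C) : Module.Free R C := by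
  induction e using Nat.strong_induction_on generalizing R N F C with
  | _ e ih
  by_cases hs : SocleFree (⊥ : Ideal R)
  · obtain ⟨x, hx, hreg⟩ := exists_regularModulo (Set.finite_singleton (⊥ : Ideal R))
      (by rintro _ rfl; exact hs)
    have hxR := RegularModulo.isSMulRegular_of_bot (hreg ⊥ rfl)
    have := isLocalRing_quotient (span_singleton_le_maximalIdeal hx)
    have hdim := ringKrullDim_quotient_span_singleton_succ_eq_ringKrullDim hxR hx
    obtain ⟨e, rfl⟩ : ∃ e', e = e' + 1 := by
      cases e with
      | zero =>
        have h0 : (0 : WithBot ℕ∞) + 1 ≤ (0 : ℕ) :=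
          le_trans (by gcongr; exact ringKrullDim_nonneg_of_nontrivial) (hdim.le.trans hR)
        exact absurd (by exact_mod_cast h0 : (1 : ℕ) ≤ 0) (by decide)
      | succ e => exact ⟨e, rfl⟩
    have hC' := hC.of_isSMulRegular hxR
    have hCx := hC'.isSMulRegular hxR
    have := hN
    have := h.finite
    have : Module.Finite R C := Module.Finite.of_surjective g h.surjective
    have : Module.FinitePresentation R C := Module.finitePresentation_of_finite R C
    refine (Module.free_quotSMulTop_iff_free R C (x := x)
      (by rwa [IsLocalRing.jacobson_eq_maximalIdeal _ bot_ne_top]) hCx).mp ?_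
    refine ih e (Nat.lt_succ_self e) ?_ (h.quotMap hCx) (free_quotSMulTop x) (finite_quotSMulTop x)
      (hC'.quotSMulTop hxR)
    rw [← hdim] at hR
    push_cast at hR
    exact ENat.WithBot.add_le_add_natCast_right_iff.mp hR
  · unfold SocleFree at hs
    push Not at hs
    obtain ⟨c, hc, hc0⟩ := hs
    refine free_of_forall_mem_smul_top h fun x hx => mem_smul_top_of_smul_eq_zero hc0 ?_
    apply h.injective
    rw [map_smul, map_zero]
    exact smul_eq_zero_of_mem_smul_top hc hx

/-- `N` has a resolution of length `p` by finitely generated free modules. -/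
def HasFreeResolution {R : Type u} [CommRing R] : ℕ → (N : Type u) → [AddCommGroup N] →
    [Module R N] → Prop
  | 0, N, _, _ => Module.Free R N ∧ Module.Finite R N
  | p + 1, N, _, _ => ∃ (K F : Type u) (_ : AddCommGroup K) (_ : Module R K) (_ : AddCommGroup F)
      (_ : Module R F) (f : K →ₗ[R] F) (g : F →ₗ[R] N),
        IsFreeSES f g ∧ HasFreeResolution (R := R) p K

lemma IsFreeSES.hasFreeResolution {R K F N : Type u} [CommRing R] [AddCommGroup K] [Module R K]
    [AddCommGroup F] [Module R F] [AddCommGroup N] [Module R N]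
    {f : K →ₗ[R] F} {g : F →ₗ[R] N} (h : IsFreeSES f g) {p : ℕ}
    (hK : HasFreeResolution (R := R) p K) : HasFreeResolution (R := R) (p + 1) N :=
  ⟨K, F, _, _, _, _, f, g, h, hK⟩

lemma HasFreeResolution.finite {R : Type u} [CommRing R] {p : ℕ} {N : Type u} [AddCommGroup N]
    [Module R N] (h : HasFreeResolution (R := R) p N) : Module.Finite R N := by
  cases p with
  | zero => exact h.2
  | succ p =>
    obtain ⟨K, F, _, _, _, _, f, g, hfg, -⟩ := h
    have := hfg.finite
    exact Module.Finite.of_surjective g hfg.surjective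

lemma HasFreeResolution.free {R : Type u} [CommRing R] [IsLocalRing R] [IsNoetherianRing R]
    {e : ℕ} (hR : ringKrullDim R ≤ e) {p : ℕ} {N : Type u} [AddCommGroup N]
    [Module R N] (h : HasFreeResolution (R := R) p N) (hN : IsSyzygyOf (1 : R) e N) :
    Module.Free R N := by
  induction p generalizing N with
  | zero => exact h.1
  | succ p ih =>
    obtain ⟨K, F, _, _, _, _, f, g, hfg, hK⟩ := h
    exact hN.free_of_isFreeSES hR hfg (ih hK (hfg.isSyzygyOf hN).pred) hK.finite

lemma IsFreeSES.baseChange {R N F C : Type u} [CommRing R] [AddCommGroup N] [Module R N]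
    [AddCommGroup F] [Module R F] [AddCommGroup C] [Module R C]
    {f : N →ₗ[R] F} {g : F →ₗ[R] C} (h : IsFreeSES f g) (A : Type u) [CommRing A] [Algebra R A]
    [Module.Flat R A] : IsFreeSES (f.baseChange A) (g.baseChange A) where
  free := have := h.free; inferInstance
  finite := have := h.finite; inferInstance
  injective := Module.Flat.lTensor_preserves_injective_linearMap (M := A) f h.injective
  surjective := LinearMap.lTensor_surjective A h.surjective
  exact := Module.Flat.lTensor_exact A h.exact

lemma IsSyzygyOf.baseChange {R : Type u} [CommRing R] {k : ℕ} {N : Type u} [AddCommGroup N]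
    [Module R N] (h : IsSyzygyOf (1 : R) k N) (A : Type u) [CommRing A] [Algebra R A]
    [Module.Flat R A] : IsSyzygyOf (1 : A) k (TensorProduct R A N) := by
  induction k generalizing N with
  | zero => exact isSyzygyOf_one_zero _
  | succ k ih =>
    obtain ⟨F, C, _, _, _, _, f, g, hfg, hC⟩ := h
    exact (hfg.baseChange A).isSyzygyOf (ih hC)

lemma HasFreeResolution.baseChange {R : Type u} [CommRing R] {p : ℕ} {N : Type u}
    [AddCommGroup N] [Module R N] (h : HasFreeResolution (R := R) p N) (A : Type u) [CommRing A]
    [Algebra R A] [Module.Flat R A] : HasFreeResolution (R := A) p (TensorProduct R A N) := by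
  induction p generalizing N with
  | zero => exact ⟨have := h.1; inferInstance, have := h.2; inferInstance⟩
  | succ p ih =>
    obtain ⟨K, F, _, _, _, _, f, g, hfg, hK⟩ := h
    exact (hfg.baseChange A).hasFreeResolution (ih hK)

lemma IsRegularLocalOfDim.free_of_isSyzygyOf {R : Type u} [CommRing R] [IsLocalRing R] {n : ℕ}
    (h : IsRegularLocalOfDim R n) {N : Type u} [AddCommGroup N] [Module R N] [Module.Finite R N]
    (hN : IsSyzygyOf (1 : R) n N) : Module.Free R N := by
  induction n generalizing R N with
  | zero =>
    have hF : IsField R := IsLocalRing.isField_iff_maximalIdeal_eq.mpr h.maximalIdeal_eq_bot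
    let := hF.toField
    exact Module.Free.of_divisionRing R N
  | succ n ih =>
    have := h.noetherian
    have := h.isDomain
    obtain ⟨w, hw, hw2, -⟩ := exists_mem_maximalIdeal_notMem_sq h.maximalIdeal_ne_bot
      Set.finite_empty (by simp) (by simp)
    have hw0 : w ≠ 0 := fun h0 => hw2 (h0 ▸ zero_mem _)
    have hwR : IsSMulRegular R w := IsSMulRegular.of_ne_zero hw0
    have := isLocalRing_quotient (span_singleton_le_maximalIdeal hw)
    have hN' := hN.of_isSMulRegular hwR
    have : Module.FinitePresentation R N := Module.finitePresentation_of_finite R N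
    have : Module.Finite (R ⧸ Ideal.span {w}) (QuotSMulTop w N) := finite_quotSMulTop w
    exact (Module.free_quotSMulTop_iff_free R N (x := w)
      (by rwa [IsLocalRing.jacobson_eq_maximalIdeal _ bot_ne_top]) (hN'.isSMulRegular hwR)).mp
      (ih (h.quotient hw hw2) (hN'.quotSMulTop hwR))

lemma exists_isFreeSES {R : Type u} [CommRing R] (N : Type u) [AddCommGroup N] [Module R N]
    [Module.Finite R N] : ∃ (m : ℕ) (g : (Fin m → R) →ₗ[R] N),
      IsFreeSES (LinearMap.ker g).subtype g := by
  obtain ⟨m, g, hg⟩ := Module.Finite.exists_fin' R N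
  exact ⟨m, g, inferInstance, inferInstance, Submodule.subtype_injective _, hg,
    LinearMap.exact_subtype_ker_map g⟩

lemma IsRegularLocalOfDim.hasFreeResolution {R : Type u} [CommRing R] [IsLocalRing R] {n : ℕ}
    (h : IsRegularLocalOfDim R n) {k p : ℕ} (hkp : k + p = n) {N : Type u} [AddCommGroup N]
    [Module R N] [Module.Finite R N] (hN : IsSyzygyOf (1 : R) k N) :
    HasFreeResolution (R := R) p N := by
  have := h.noetherian
  induction p generalizing k N with
  | zero => obtain rfl : k = n := hkp; exact ⟨h.free_of_isSyzygyOf hN, ‹_›⟩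
  | succ p ih =>
    obtain ⟨m, g, hg⟩ := exists_isFreeSES (R := R) N
    exact hg.hasFreeResolution (ih (by omega) (hg.isSyzygyOf hN))

/-- All terms of the resolution are finitely generated free. -/
def ProjRes.IsFree {R : Type u} [CommRing R] {M : Type u} [AddCommGroup M] [Module R M]
    (P : ProjRes R M) : Prop :=
  ∀ n, Module.Free R (P.F n) ∧ Module.Finite R (P.F n)

/-- The resolution of `C` obtained by splicing a resolution of `M` with `M → F → C`. -/
def ProjRes.splice {R M F C : Type u} [CommRing R] [AddCommGroup M] [Module R M]
    [AddCommGroup F] [Module R F] [AddCommGroup C] [Module R C] {f : M →ₗ[R] F} {g : F →ₗ[R] C}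
    (P : ProjRes R M) (h : IsFreeSES f g) : ProjRes R C where
  F
    | 0 => ModuleCat.of R F
    | n + 1 => P.F n
  d
    | 0 => f.comp P.ε
    | n + 1 => P.d n
  ε := g
  projective
    | 0 => have := h.free; inferInstanceAs (Module.Projective R F)
    | n + 1 => P.projective n
  surj := h.surjective
  exact0 := by
    rw [LinearMap.range_comp_of_range_eq_top _ (LinearMap.range_eq_top.mpr P.surj)]
    exact h.exact.linearMap_ker_eq
  exact
    | 0 => by
      rw [← P.exact0]
      exact LinearMap.ker_comp_of_ker_eq_bot _ (LinearMap.ker_eq_bot.mpr h.injective)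
    | n + 1 => P.exact n

lemma ProjRes.IsFree.splice {R M F C : Type u} [CommRing R] [AddCommGroup M] [Module R M]
    [AddCommGroup F] [Module R F] [AddCommGroup C] [Module R C] {f : M →ₗ[R] F} {g : F →ₗ[R] C}
    {P : ProjRes R M} (hP : P.IsFree) (h : IsFreeSES f g) : (P.splice h).IsFree
  | 0 => ⟨h.free, h.finite⟩
  | n + 1 => hP n

/-- A finitely generated free module resolves itself. -/
def ProjRes.self (R M : Type u) [CommRing R] [AddCommGroup M] [Module R M]
    [Module.Projective R M] : ProjRes R M where
  F
    | 0 => ModuleCat.of R M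
    | _ + 1 => ModuleCat.of R PUnit.{u + 1}
  d _ := 0
  ε := LinearMap.id
  projective
    | 0 => inferInstanceAs (Module.Projective R M)
    | _ + 1 => inferInstanceAs (Module.Projective R PUnit.{u + 1})
  surj := Function.surjective_id
  exact0 := by rw [LinearMap.range_zero]; exact LinearMap.ker_id
  exact n := by
    have : Subsingleton (ModuleCat.of R PUnit.{u + 1}) :=
      inferInstanceAs (Subsingleton PUnit.{u + 1})
    ext x
    have : x = 0 := Subsingleton.elim (α := PUnit.{u + 1}) _ _
    simp [this]

lemma HasFreeResolution.hasFiniteFreeResolution {R : Type u} [CommRing R] {p : ℕ} {N : Type u}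
    [AddCommGroup N] [Module R N] (h : HasFreeResolution (R := R) p N) :
    HasFiniteFreeResolution R N := by
  induction p generalizing N with
  | zero =>
    obtain ⟨h1, h2⟩ := h
    refine ⟨ProjRes.self R N, 1, ?_, ?_⟩
    · rintro (_ | n)
      · exact ⟨h1, h2⟩
      · exact ⟨inferInstanceAs (Module.Free R PUnit.{u + 1}),
          inferInstanceAs (Module.Finite R PUnit.{u + 1})⟩
    · rintro (_ | n) hn
      · omega
      · exact inferInstanceAs (Subsingleton PUnit.{u + 1})
  | succ p ih =>
    obtain ⟨K, F, _, _, _, _, f, g, hfg, hK⟩ := h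
    obtain ⟨P, n, hP, hn⟩ := ih hK
    refine ⟨P.splice hfg, n + 1, ProjRes.IsFree.splice hP hfg, ?_⟩
    rintro (_ | j) hj
    · omega
    · exact hn j (by omega)

lemma IsSyzygyOf.exists_projRes {R : Type u} [CommRing R] {k : ℕ} {C : Type u} [AddCommGroup C]
    [Module R C] (hC : IsSyzygyOf (1 : R) k C) {P : ProjRes R C} (hP : P.IsFree) (i : ℕ)
    {X : Type u} [AddCommGroup X] [Module R X] (hX : Nonempty (X ≃ₗ[R] LinearMap.range (P.d i))) :
    ∃ (N : Type u) (_ : AddCommGroup N) (_ : Module R N) (P' : ProjRes R N),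
      P'.IsFree ∧ Nonempty (X ≃ₗ[R] LinearMap.range (P'.d (i + k))) := by
  induction k generalizing C i with
  | zero => exact ⟨C, _, _, P, hP, hX⟩
  | succ k ih =>
    obtain ⟨F, D, _, _, _, _, f, g, hfg, hD⟩ := hC
    obtain ⟨N, _, _, P', hP', hX'⟩ := ih hD (hP.splice hfg) (i + 1) hX
    refine ⟨N, _, _, P', hP', ?_⟩
    rwa [show i + (k + 1) = i + 1 + k by ring]

lemma IsSyzygyOf.isSyzygy {R : Type u} [CommRing R] {k : ℕ} {M : Type u} [AddCommGroup M]
    [Module R M] (hM : IsSyzygyOf (1 : R) k M) (hR : HasFiniteFreeResolution R M) :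
    IsSyzygy R k M := by
  cases k with
  | zero => trivial
  | succ k =>
    obtain ⟨F, C, _, _, _, _, f, g, hfg, hC⟩ := hM
    obtain ⟨P, -, hP, -⟩ := hR
    have := hC.exists_projRes (ProjRes.IsFree.splice hP hfg) 0 (X := M) (by
      have h1 : LinearMap.range ((P.splice hfg).d 0) = LinearMap.range f :=
        LinearMap.range_comp_of_range_eq_top _ (LinearMap.range_eq_top.mpr P.surj)
      rw [h1]
      exact ⟨LinearEquiv.ofInjective f hfg.injective⟩)
    rwa [zero_add] at this

lemma IsFreeSES.mem_of_mem_smul_top {R N F C : Type u} [CommRing R] [AddCommGroup N] [Module R N]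
    [AddCommGroup F] [Module R F] [AddCommGroup C] [Module R C]
    {f : N →ₗ[R] F} {g : F →ₗ[R] C} (h : IsFreeSES f g) {Q : Ideal R} [Q.IsPrime]
    (hC : Module.Free (Localization.AtPrime Q) (TensorProduct R (Localization.AtPrime Q) C))
    {y : N} (hy : f y ∈ Q • (⊤ : Submodule R F)) (φ : N →ₗ[R] R) : φ y ∈ Q := by
  have hS := h.baseChange (Localization.AtPrime Q)
  obtain ⟨s, hs⟩ := Module.projective_lifting_property
    (g.baseChange (Localization.AtPrime Q)) LinearMap.id hS.surjective
  obtain ⟨-, r, hr⟩ := (List.TFAE.out hS.exact.split_tfae' 0 1 rfl rfl).mp ⟨hS.injective, s, hs⟩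
  let Φ : TensorProduct R (Localization.AtPrime Q) N →ₗ[Localization.AtPrime Q]
      Localization.AtPrime Q := LinearMap.liftBaseChange _ (Algebra.linearMap R _ ∘ₗ φ)
  let θ : F →ₗ[R] Localization.AtPrime Q :=
    ((Φ ∘ₗ r).restrictScalars R) ∘ₗ TensorProduct.mk R (Localization.AtPrime Q) F 1
  have h1 : θ (f y) = algebraMap R _ (φ y) := by
    have := LinearMap.congr_fun hr (TensorProduct.tmul R 1 y)
    simp only [LinearMap.comp_apply, LinearMap.baseChange_tmul, LinearMap.id_apply] at this
    simp [θ, this, Φ]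
  have h2 : ∀ v ∈ Q • (⊤ : Submodule R F), θ v ∈ maximalIdeal (Localization.AtPrime Q) := by
    intro v hv
    induction hv using Submodule.smul_induction_on' with
    | smul a ha v _ =>
      rw [map_smul, Algebra.smul_def]
      exact Ideal.mul_mem_right _ _
        ((IsLocalization.AtPrime.to_map_mem_maximal_iff (Localization.AtPrime Q) Q a).mpr ha)
    | add v _ w _ hv hw => rw [map_add]; exact add_mem hv hw
  exact (IsLocalization.AtPrime.to_map_mem_maximal_iff (Localization.AtPrime Q) Q _).mp
    (h1 ▸ h2 _ hy)

lemma OrderIdealConjecture.mem_smul_top {R : Type u} [CommRing R] [IsLocalRing R]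
    [IsNoetherianRing R] (hR : OrderIdealConjecture R) {N F C : Type u}
    [AddCommGroup N] [Module R N] [AddCommGroup F] [Module R F] [AddCommGroup C] [Module R C]
    {f : N →ₗ[R] F} {g : F →ₗ[R] C} (h : IsFreeSES f g) {p : ℕ}
    (hN : HasFreeResolution (R := R) p N) {k : ℕ} (hC : IsSyzygyOf (1 : R) k C) {Q : Ideal R}
    [Q.IsPrime] (hQ : ringKrullDim (Localization.AtPrime Q) ≤ k) {y : N}
    (hy : f y ∈ Q • (⊤ : Submodule R F)) : y ∈ maximalIdeal R • (⊤ : Submodule R N) := by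
  by_contra hym
  have hfin := hN.finite
  have hfree : Module.Free (Localization.AtPrime Q) (TensorProduct R (Localization.AtPrime Q) C) :=
    ((h.hasFreeResolution hN).baseChange _).free hQ (hC.baseChange _)
  have hle : orderIdeal R y ≤ Q := by
    rintro _ ⟨φ, rfl⟩
    exact h.mem_of_mem_smul_top hfree hy φ
  have hgrade := hR N _ _ hfin hN.hasFiniteFreeResolution (k + 1)
    ((h.isSyzygyOf hC).isSyzygy hN.hasFiniteFreeResolution) y hym
  rcases hgrade with htop | ⟨rs, hlen, hmem, hreg⟩
  · exact Ideal.IsPrime.ne_top (I := Q) inferInstance (top_le_iff.mp (htop ▸ hle))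
  · have := (length_le_ringKrullDim_localization hreg fun r hr => hle (hmem r hr)).trans hQ
    rw [hlen] at this
    have : k + 1 ≤ k := by exact_mod_cast this
    omega

lemma IsFreeSES.mem_smul_top {R N F C : Type u} [CommRing R] [IsLocalRing R]
    [AddCommGroup N] [Module R N] [AddCommGroup F] [Module R F] [AddCommGroup C] [Module R C]
    {f : N →ₗ[R] F} {g : F →ₗ[R] C} (h : IsFreeSES f g) {n : ℕ}
    (hR : IsRegularLocalOfDim R (n + 1)) {w : R} (hw : w ∈ maximalIdeal R)
    (hw2 : w ∉ maximalIdeal R ^ 2) [IsLocalRing (R ⧸ Ideal.span {w})]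
    (hOIC : OrderIdealConjecture (R ⧸ Ideal.span {w})) {k : ℕ} (hC : IsSyzygyOf w k C)
    {Q : Ideal (R ⧸ Ideal.span {w})} [Q.IsPrime] (hQ : ringKrullDim (Localization.AtPrime Q) ≤ k)
    {P : Ideal R} (hPQ : P.map (Ideal.Quotient.mk _) ≤ Q) {y : N}
    (hy : f y ∈ P • (⊤ : Submodule R F)) : y ∈ maximalIdeal R • (⊤ : Submodule R N) := by
  have := hR.noetherian
  have := hR.isDomain
  have := h.finite
  have : Module.Finite R N := Module.Finite.of_injective f h.injective
  have hw0 : w ≠ 0 := fun h0 => hw2 (h0 ▸ zero_mem _)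
  have hwR : IsSMulRegular R w := IsSMulRegular.of_ne_zero hw0
  have := finite_quotSMulTop (M := N) w
  have hmkF : ∀ v ∈ P • (⊤ : Submodule R F), (Submodule.Quotient.mk v : QuotSMulTop w F) ∈
      Q • (⊤ : Submodule (R ⧸ Ideal.span {w}) (QuotSMulTop w F)) := by
    intro v hv
    induction hv using Submodule.smul_induction_on' with
    | smul a ha v _ =>
      exact Submodule.smul_mem_smul (N := (⊤ : Submodule (R ⧸ Ideal.span {w}) (QuotSMulTop w F)))
        (n := Submodule.Quotient.mk v) (hPQ (Ideal.mem_map_of_mem _ ha)) trivial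
    | add v _ v' _ hv hv' => rw [Submodule.Quotient.mk_add]; exact add_mem hv hv'
  have hmkN : ∀ z ∈ maximalIdeal (R ⧸ Ideal.span {w}) •
      (⊤ : Submodule (R ⧸ Ideal.span {w}) (QuotSMulTop w N)),
      ∃ y ∈ maximalIdeal R • (⊤ : Submodule R N),
        (Submodule.Quotient.mk y : QuotSMulTop w N) = z := by
    intro z hz
    induction hz using Submodule.smul_induction_on' with
    | smul a ha v _ =>
      rw [← map_maximalIdeal_of_surjective _ Ideal.Quotient.mk_surjective,
        Ideal.mem_map_iff_of_surjective _ Ideal.Quotient.mk_surjective] at ha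
      obtain ⟨a, ha, rfl⟩ := ha
      obtain ⟨v, rfl⟩ := Submodule.Quotient.mk_surjective _ v
      exact ⟨a • v, Submodule.smul_mem_smul ha trivial, rfl⟩
    | add v _ v' _ hv hv' =>
      obtain ⟨v, h1, rfl⟩ := hv
      obtain ⟨v', h2, rfl⟩ := hv'
      exact ⟨v + v', add_mem h1 h2, rfl⟩
  have := (hR.quotient hw hw2).noetherian
  obtain ⟨y', hy', heq⟩ := hmkN _ (hOIC.mem_smul_top (h.quotMap (hC.isSMulRegular hwR))
    ((hR.quotient hw hw2).hasFreeResolution (zero_add n) (isSyzygyOf_one_zero _))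
    (hC.quotSMulTop hwR) hQ (y := Submodule.Quotient.mk y) (hmkF _ hy))
  rw [Submodule.Quotient.eq] at heq
  have h3 : y' - y ∈ maximalIdeal R • (⊤ : Submodule R N) := by
    obtain ⟨u, -, hu⟩ := (Submodule.mem_smul_pointwise_iff_exists _ _ _).mp heq
    rw [← hu]
    exact Submodule.smul_mem_smul hw trivial
  simpa using sub_mem hy' h3

lemma ProjRes.IsFree.isFreeSES {R M : Type u} [CommRing R] [AddCommGroup M] [Module R M]
    {P : ProjRes R M} (hP : P.IsFree) (t : ℕ) :
    IsFreeSES (LinearMap.range (P.d (t + 1))).subtype (P.d t).rangeRestrict where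
  free := (hP _).1
  finite := (hP _).2
  injective := Submodule.subtype_injective _
  surjective := LinearMap.surjective_rangeRestrict _
  exact := by
    rw [LinearMap.exact_iff, LinearMap.ker_rangeRestrict, Submodule.range_subtype, P.exact]

lemma ProjRes.IsFree.isFreeSES_zero {R M : Type u} [CommRing R] [AddCommGroup M] [Module R M]
    {P : ProjRes R M} (hP : P.IsFree) :
    IsFreeSES (LinearMap.range (P.d 0)).subtype P.ε where
  free := (hP _).1
  finite := (hP _).2
  injective := Submodule.subtype_injective _
  surjective := P.surj
  exact := by
    rw [LinearMap.exact_iff, Submodule.range_subtype, P.exact0]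

lemma ProjRes.IsFree.isSyzygyOf {R M : Type u} [CommRing R] [AddCommGroup M] [Module R M]
    {P : ProjRes R M} (hP : P.IsFree) {w : R} (hw : IsSMulRegular M w) (t : ℕ) :
    IsSyzygyOf w (t + 1) (LinearMap.range (P.d t)) := by
  induction t with
  | zero => exact hP.isFreeSES_zero.isSyzygyOf hw
  | succ t ih => exact (hP.isFreeSES t).isSyzygyOf ih

lemma ProjRes.mem_range_sup_of_mem_smul_top {R M : Type u} [CommRing R] [AddCommGroup M]
    [Module R M] {P : ProjRes R M} {J : Ideal R} {j : ℕ} {v : P.F (j + 1)}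
    (h : (P.d j).rangeRestrict v ∈ J • (⊤ : Submodule R (LinearMap.range (P.d j)))) :
    v ∈ LinearMap.range (P.d (j + 1)) ⊔ J • (⊤ : Submodule R (P.F (j + 1))) := by
  have hmap : (J • ⊤ : Submodule R (P.F (j + 1))).map (P.d j).rangeRestrict = J • ⊤ := by
    rw [Submodule.map_smul'', Submodule.map_top, LinearMap.range_rangeRestrict]
  rw [← hmap] at h
  obtain ⟨v', hv', heq⟩ := h
  rw [← sub_add_cancel v v']
  refine Submodule.add_mem_sup ?_ hv'
  rw [← P.exact, ← LinearMap.ker_rangeRestrict, LinearMap.mem_ker, map_sub, heq, sub_self]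

lemma koszulD_mem {R : Type u} [CommRing R] {s : ℕ} {x : Fin s → R} {I : Ideal R}
    (hx : ∀ j, x j ∈ I) (n : ℕ) (v : KMod R s (n + 1)) :
    koszulD R x n v ∈ I • (⊤ : Submodule R (KMod R s n)) := by
  rw [koszulD, Finsupp.lsum_apply]
  refine Submodule.sum_mem _ fun T _ => ?_
  refine Submodule.smul_mem (I • ⊤) (v T) (Submodule.sum_mem _ fun j _ => ?_)
  exact Submodule.smul_mem_smul (Ideal.mul_mem_left _ _ (hx _)) trivial

lemma map_mem_smul_top {R M N : Type u} [CommRing R] [AddCommGroup M] [Module R M]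
    [AddCommGroup N] [Module R N] (f : M →ₗ[R] N) {I : Ideal R} {v : M}
    (hv : v ∈ I • (⊤ : Submodule R M)) : f v ∈ I • (⊤ : Submodule R N) := by
  have := Submodule.mem_map_of_mem (f := f) hv
  rw [Submodule.map_smul''] at this
  exact Submodule.smul_mono le_rfl le_top this

lemma exists_comp_eq_of_forall_mem_range {R X M N : Type u} [CommRing R] [AddCommGroup X]
    [Module R X] [AddCommGroup M] [Module R M] [AddCommGroup N] [Module R N]
    [Module.Projective R X] (f : M →ₗ[R] N) (a : X →ₗ[R] N) (h : ∀ v, a v ∈ LinearMap.range f) :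
    ∃ b : X →ₗ[R] M, f ∘ₗ b = a := by
  obtain ⟨b, hb⟩ := Module.projective_lifting_property f.rangeRestrict
    (a.codRestrict (LinearMap.range f) h) f.surjective_rangeRestrict
  refine ⟨b, LinearMap.ext fun v => ?_⟩
  exact congrArg Subtype.val (LinearMap.congr_fun hb v)

lemma ProjRes.d_d {R M : Type u} [CommRing R] [AddCommGroup M] [Module R M] (P : ProjRes R M)
    (n : ℕ) (v : P.F (n + 2)) : P.d n (P.d (n + 1) v) = 0 := by
  rw [← LinearMap.mem_ker, P.exact]
  exact ⟨v, rfl⟩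

lemma ProjRes.exists_lift_zero {R M : Type u} [CommRing R] [AddCommGroup M] [Module R M]
    (P G : ProjRes R M) : ∃ a : P.F 0 →ₗ[R] G.F 0, G.ε ∘ₗ a = P.ε :=
  have := P.projective 0
  Module.projective_lifting_property G.ε P.ε G.surj

lemma ProjRes.exists_lift_one {R M : Type u} [CommRing R] [AddCommGroup M] [Module R M]
    (P G : ProjRes R M) {a : P.F 0 →ₗ[R] G.F 0} (ha : G.ε ∘ₗ a = P.ε) :
    ∃ b : P.F 1 →ₗ[R] G.F 1, a ∘ₗ P.d 0 = G.d 0 ∘ₗ b := by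
  have := P.projective 1
  obtain ⟨b, hb⟩ := exists_comp_eq_of_forall_mem_range (G.d 0) (a ∘ₗ P.d 0) fun v => by
    rw [← G.exact0, LinearMap.mem_ker, LinearMap.comp_apply]
    refine (LinearMap.congr_fun ha (P.d 0 v)).trans ?_
    rw [← LinearMap.mem_ker, P.exact0]
    exact ⟨v, rfl⟩
  exact ⟨b, hb.symm⟩

lemma ProjRes.exists_lift_succ {R M : Type u} [CommRing R] [AddCommGroup M] [Module R M]
    (P G : ProjRes R M) {n : ℕ} {a : P.F n →ₗ[R] G.F n} {b : P.F (n + 1) →ₗ[R] G.F (n + 1)}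
    (h : a ∘ₗ P.d n = G.d n ∘ₗ b) :
    ∃ c : P.F (n + 2) →ₗ[R] G.F (n + 2), b ∘ₗ P.d (n + 1) = G.d (n + 1) ∘ₗ c := by
  have := P.projective (n + 2)
  obtain ⟨c, hc⟩ := exists_comp_eq_of_forall_mem_range (G.d (n + 1)) (b ∘ₗ P.d (n + 1)) fun v => by
    rw [← G.exact, LinearMap.mem_ker, LinearMap.comp_apply]
    refine (LinearMap.congr_fun h (P.d (n + 1) v)).symm.trans ?_
    rw [LinearMap.comp_apply, P.d_d, map_zero]
  exact ⟨c, hc.symm⟩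

/-- Consecutive components of a comparison map between two projective resolutions. -/
noncomputable def ProjRes.liftAux {R M : Type u} [CommRing R] [AddCommGroup M] [Module R M]
    (P G : ProjRes R M) : ∀ n, {p : (P.F n →ₗ[R] G.F n) × (P.F (n + 1) →ₗ[R] G.F (n + 1)) //
      p.1 ∘ₗ P.d n = G.d n ∘ₗ p.2}
  | 0 => ⟨⟨_, _⟩, (P.exists_lift_one G (P.exists_lift_zero G).choose_spec).choose_spec⟩
  | n + 1 => ⟨⟨_, _⟩, (P.exists_lift_succ G (ProjRes.liftAux P G n).2).choose_spec⟩

/-- The comparison map between two projective resolutions. -/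
noncomputable def ProjRes.lift {R M : Type u} [CommRing R] [AddCommGroup M] [Module R M]
    (P G : ProjRes R M) (n : ℕ) : P.F n →ₗ[R] G.F n :=
  (P.liftAux G n).1.1

lemma ProjRes.lift_comm {R M : Type u} [CommRing R] [AddCommGroup M] [Module R M]
    (P G : ProjRes R M) (n : ℕ) : P.lift G n ∘ₗ P.d n = G.d n ∘ₗ P.lift G (n + 1) :=
  (P.liftAux G n).2

lemma ProjRes.ε_lift {R M : Type u} [CommRing R] [AddCommGroup M] [Module R M]
    (P G : ProjRes R M) : G.ε ∘ₗ P.lift G 0 = P.ε :=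
  (P.exists_lift_zero G).choose_spec

lemma ProjRes.exists_homotopy {R M : Type u} [CommRing R] [AddCommGroup M] [Module R M]
    (P : ProjRes R M) {θ : ∀ n, P.F n →ₗ[R] P.F n}
    (hθ : ∀ n, θ n ∘ₗ P.d n = P.d n ∘ₗ θ (n + 1)) (h0 : P.ε ∘ₗ θ 0 = 0) (n : ℕ) :
    ∃ (H : P.F n →ₗ[R] P.F (n + 1)) (H' : P.F (n + 1) →ₗ[R] P.F (n + 2)),
      θ (n + 1) = P.d (n + 1) ∘ₗ H' + H ∘ₗ P.d n := by
  have step : ∀ (n : ℕ) (H : P.F n →ₗ[R] P.F (n + 1)),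
      P.d n ∘ₗ H ∘ₗ P.d n = θ n ∘ₗ P.d n → ∃ H' : P.F (n + 1) →ₗ[R] P.F (n + 2),
        P.d (n + 1) ∘ₗ H' = θ (n + 1) - H ∘ₗ P.d n := by
    intro n H h
    have := P.projective (n + 1)
    refine exists_comp_eq_of_forall_mem_range _ _ fun v => ?_
    rw [← P.exact, LinearMap.mem_ker, LinearMap.sub_apply, map_sub, sub_eq_zero]
    exact (LinearMap.congr_fun (hθ n) v).symm.trans (LinearMap.congr_fun h v).symm
  have key : ∀ n, ∃ H : P.F n →ₗ[R] P.F (n + 1), P.d n ∘ₗ H ∘ₗ P.d n = θ n ∘ₗ P.d n := by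
    intro n
    induction n with
    | zero =>
      have := P.projective 0
      obtain ⟨H, hH⟩ := exists_comp_eq_of_forall_mem_range (P.d 0) (θ 0) fun v => by
        rw [← P.exact0]
        exact LinearMap.congr_fun h0 v
      exact ⟨H, by rw [← LinearMap.comp_assoc, hH]⟩
    | succ n ih =>
      obtain ⟨H, hH⟩ := ih
      obtain ⟨H', hH'⟩ := step n H hH
      refine ⟨H', ?_⟩
      rw [← LinearMap.comp_assoc, hH']
      ext v
      simp [P.d_d]
  obtain ⟨H, hH⟩ := key n
  obtain ⟨H', hH'⟩ := step n H hH
  exact ⟨H, H', by rw [hH', sub_add_cancel]⟩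

lemma ProjRes.mem_of_lift_mem {R M : Type u} [CommRing R] [AddCommGroup M] [Module R M]
    {P G : ProjRes R M} {J : Ideal R} {n : ℕ} {v : P.F (n + 1)}
    (hd : P.d n v ∈ J • (⊤ : Submodule R (P.F n)))
    (hv : P.lift G (n + 1) v ∈
      LinearMap.range (G.d (n + 1)) ⊔ J • (⊤ : Submodule R (G.F (n + 1)))) :
    v ∈ LinearMap.range (P.d (n + 1)) ⊔ J • (⊤ : Submodule R (P.F (n + 1))) := by
  obtain ⟨H, H', hH⟩ := P.exists_homotopy
    (θ := fun n => LinearMap.id - G.lift P n ∘ₗ P.lift G n)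
    (fun n => by
      rw [LinearMap.sub_comp, LinearMap.comp_sub, LinearMap.comp_assoc, P.lift_comm,
        ← LinearMap.comp_assoc, G.lift_comm, LinearMap.comp_assoc, LinearMap.comp_id,
        LinearMap.id_comp])
    (by rw [LinearMap.comp_sub, ← LinearMap.comp_assoc, G.ε_lift, P.ε_lift, LinearMap.comp_id,
      sub_self]) n
  have h1 : v = P.d (n + 1) (H' v) + H (P.d n v) + G.lift P (n + 1) (P.lift G (n + 1) v) :=
    sub_eq_iff_eq_add.mp (LinearMap.congr_fun hH v)
  rw [h1]
  refine add_mem (Submodule.add_mem_sup ⟨_, rfl⟩ (map_mem_smul_top H hd)) ?_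
  obtain ⟨_, ⟨a, rfl⟩, b, hb, heq⟩ := Submodule.mem_sup.mp hv
  rw [← heq, map_add]
  refine Submodule.add_mem_sup ⟨G.lift P _ a, ?_⟩ (map_mem_smul_top _ hb)
  exact (LinearMap.congr_fun (G.lift_comm P (n + 1)) a).symm

lemma ProjRes.IsFree.exists_isFreeSES {R M : Type u} [CommRing R] [AddCommGroup M] [Module R M]
    {P : ProjRes R M} (hP : P.IsFree) (j : ℕ) :
    ∃ (C : Type u) (_ : AddCommGroup C) (_ : Module R C) (g : P.F j →ₗ[R] C),
      IsFreeSES (LinearMap.range (P.d j)).subtype g ∧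
        ∀ w : R, IsSMulRegular M w → IsSyzygyOf w j C := by
  cases j with
  | zero => exact ⟨M, _, _, P.ε, hP.isFreeSES_zero, fun _ hw => hw⟩
  | succ t => exact ⟨_, _, _, _, hP.isFreeSES t, fun _ hw => hP.isSyzygyOf hw t⟩

lemma RegularModulo.socleFree {R : Type u} [CommRing R] [IsLocalRing R] {J : Ideal R} {r : R}
    (hr : r ∈ maximalIdeal R) (h : RegularModulo J r) : SocleFree J :=
  fun u hu => h u (hu r hr)

lemma SocleFree.exists_isSMulRegular {R : Type u} [CommRing R] [IsLocalRing R]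
    [IsNoetherianRing R] (hm : maximalIdeal R ≠ ⊥) {J : Ideal R} (h : SocleFree J) :
    ∃ w ∈ maximalIdeal R, w ∉ maximalIdeal R ^ 2 ∧ IsSMulRegular (R ⧸ J) w := by
  obtain ⟨w, hw, hw2, hp⟩ := exists_mem_maximalIdeal_notMem_sq hm
    (associatedPrimes.finite R (R ⧸ J)) (fun p hp => (exists_of_mem_associatedPrimes hp).1)
    (fun p hp => h.ne_maximalIdeal hp)
  exact ⟨w, hw, hw2, RegularModulo.iff_isSMulRegular.mp (regularModulo_of_forall_notMem hp)⟩

/-- The data for reducing modulo an element `w ∈ m ∖ m²` that bounds the height of `I` after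
reduction by the syzygy order that survives the reduction. -/
lemma IsRegularLocalOfDim.exists_reduction {R : Type u} [CommRing R] [IsLocalRing R] {n : ℕ}
    (hR : IsRegularLocalOfDim R (n + 1)) {I : Ideal R} {d : ℕ} (hht : HeightEq R I d)
    (hcase : (∃ w ∈ I, w ∈ maximalIdeal R ∧ w ∉ maximalIdeal R ^ 2) ∨
      (∃ r ∈ maximalIdeal R, IsSMulRegular (R ⧸ I) r)) {j : ℕ} (hj : d ≤ j) :
    ∃ w ∈ maximalIdeal R, w ∉ maximalIdeal R ^ 2 ∧
      ∃ (Q : Ideal (R ⧸ Ideal.span {w})) (_ : Q.IsPrime) (k : ℕ),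
        I.map (Ideal.Quotient.mk _) ≤ Q ∧ ringKrullDim (Localization.AtPrime Q) ≤ k ∧
        ∀ (C : Type u) (_ : AddCommGroup C) (_ : Module R C),
          (∀ w : R, IsSMulRegular (R ⧸ I) w → IsSyzygyOf w j C) → IsSyzygyOf w k C := by
  have := hR.noetherian
  have := hR.isDomain
  obtain ⟨⟨P, hP, hIP, hPd⟩, -⟩ := hht
  rcases hcase with ⟨w, hwI, hw, hw2⟩ | ⟨r, hr, hreg⟩
  · obtain ⟨Q, hQ, e, hPQ, he, hed⟩ := hR.exists_prime_of_mem hw hw2 (hIP hwI) hPd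
    obtain ⟨t, rfl⟩ : ∃ t, j = t + 1 := ⟨j - 1, by omega⟩
    have hw0 : w ≠ 0 := fun h0 => hw2 (h0 ▸ zero_mem _)
    refine ⟨w, hw, hw2, Q, hQ, t, (Ideal.map_mono hIP).trans hPQ, ?_, fun C _ _ hC => ?_⟩
    · rw [he]
      exact_mod_cast (by omega : e ≤ t)
    · exact (hC 1 (IsSMulRegular.one _)).of_isSMulRegular (IsSMulRegular.of_ne_zero hw0)
  · obtain ⟨w, hw, hw2, hwI⟩ := ((RegularModulo.iff_isSMulRegular.mpr hreg).socleFree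
      hr).exists_isSMulRegular hR.maximalIdeal_ne_bot
    obtain ⟨Q, hQ, e, hPQ, he, hed⟩ := hR.exists_prime hw hw2 hPd
    refine ⟨w, hw, hw2, Q, hQ, j, (Ideal.map_mono hIP).trans hPQ, ?_, fun C _ _ hC => hC w hwI⟩
    rw [he]
    exact_mod_cast hed.trans hj

/-- Let `(R,m,k)` be a regular local ring of dimension `n` and
assume that the order ideal conjecture holds for every regular local ring of
dimension `n − 1`.  Let `I` be an ideal of height `d` with minimal set of
generators `x₁,…,x_s`.  If `I` contains an element of `m ∖ m²`, or if
`depth R/I > 0`, then for every `i ≥ 1` the natural map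
`K_{d+i}(x;R) ⊗_R k → Tor_{d+i}^R(R/I, k)` is the zero map. -/
theorem statement5
    (R : Type u) [CommRing R] [IsLocalRing R] (hreg : IsRegularLocal R)
    (n : ℕ) (hdim : ringKrullDim R = n)
    (hOIC : ∀ (R' : Type u) [CommRing R'] [IsLocalRing R'],
      IsRegularLocal R' → ringKrullDim R' = (n - 1 : ℕ) → OrderIdealConjecture R')
    (I : Ideal R) (d : ℕ) (hht : HeightEq R I d)
    {s : ℕ} (x : Fin s → R) (hmin : MinimalGenerators R x I)
    (hcase : (∃ w ∈ I, w ∈ maximalIdeal R ∧ w ∉ (maximalIdeal R) ^ 2) ∨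
      (∃ r ∈ maximalIdeal R, IsSMulRegular (R ⧸ I) r))
    (i : ℕ) (hi : 1 ≤ i) :
    KoszulTorMapZero R x I (d + i) := by
  have hxI : ∀ j, x j ∈ I := fun j => hmin.1 ▸ Ideal.subset_span ⟨j, rfl⟩
  have hI : I ≠ ⊤ := by
    obtain ⟨⟨P, hP, hIP, -⟩, -⟩ := hht
    exact fun h => hP.ne_top (top_le_iff.mp (h ▸ hIP))
  have hR := IsRegularLocalOfDim.of_isRegularLocal hreg hdim
  cases n with
  | zero =>
    have hbot := hR.maximalIdeal_eq_bot
    rcases hcase with ⟨w, -, hw, hw2⟩ | ⟨r, hr, hr2⟩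
    · rw [hbot, Ideal.mem_bot] at hw
      exact absurd (hw ▸ zero_mem _) hw2
    · rw [hbot, Ideal.mem_bot] at hr
      subst hr
      exact absurd (Ideal.Quotient.subsingleton_iff.mp hr2.subsingleton) hI
  | succ n =>
    obtain ⟨j, hj⟩ : ∃ j, d + i = j + 1 := ⟨d + i - 1, by omega⟩
    rw [hj]
    obtain ⟨w, hw, hw2, Q, hQ, k, hIQ, hQk, hk⟩ := hR.exists_reduction hht hcase
      (j := j) (by omega)
    have := isLocalRing_quotient (span_singleton_le_maximalIdeal hw)
    have hR' := hR.quotient hw hw2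
    obtain ⟨G, -, hG, -⟩ := (hR.hasFreeResolution (zero_add _)
      (isSyzygyOf_one_zero (R ⧸ I))).hasFiniteFreeResolution
    obtain ⟨C, _, _, g, hg, hC⟩ := ProjRes.IsFree.exists_isFreeSES hG j
    intro P L v
    have hL : P.d j (L.ψ (j + 1) v) = L.ψ j (koszulD R x j v) :=
      (LinearMap.congr_fun (L.comm j) v).symm
    refine ProjRes.mem_of_lift_mem (G := G) ?_ (ProjRes.mem_range_sup_of_mem_smul_top ?_)
    · rw [hL]
      exact Submodule.smul_mono_left (le_maximalIdeal hI)
        (map_mem_smul_top _ (koszulD_mem hxI j v))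
    · refine hg.mem_smul_top hR hw hw2 (hOIC _ hR'.isRegularLocal hR'.dim) (hk C _ _ hC) hQk hIQ ?_
      have h1 : G.d j (P.lift G (j + 1) (L.ψ (j + 1) v)) =
          P.lift G j (L.ψ j (koszulD R x j v)) :=
        (LinearMap.congr_fun (P.lift_comm G j) _).symm.trans (congrArg _ hL)
      exact h1 ▸ map_mem_smul_top _ (map_mem_smul_top _ (koszulD_mem hxI j v))
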